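/- arXiv:1710.02783 — 7 statements merged into one kernel-verified Lean document; each statement's English description precedes it below -/
import Mathlib

section
/- Let Ω ⊆ ℝ³ be open and t ∈ ℝ. Let s : Ω → ℝ and n : Ω → S² be smooth and suppose Q = s (n⊗n − (1/3)I) solves the one-constant Landau–de Gennes Euler–Lagrange equations on Ω. Then on all of Ω: (i) Δs = 3 |∇n|² s + t s − √6 s² + (4/3) s³, and (ii) s Δn + 2 (∇s·∇) n + s |∇n|² n = 0, where ((∇s·∇)n)_i = Σ_k (∂_k s)(∂_k n_i); moreover, (iii) at every point of Ω where s ≠ 0 the director n satisfies the extra equation 2 Σ_{k=1}^{3} ∂_k n ⊗ ∂_k n + |∇n|² (n ⊗ n − I) = 0. -/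
open Real Set

noncomputable section

/-- Partial derivative in direction `i`. -/
def pd (i : Fin 3) (f : (Fin 3 → ℝ) → ℝ) (x : Fin 3 → ℝ) : ℝ :=
  fderiv ℝ f x (Pi.single i 1)

/-- Laplacian on ℝ³. -/
def lap (f : (Fin 3 → ℝ) → ℝ) (x : Fin 3 → ℝ) : ℝ :=
  ∑ i : Fin 3, pd i (fun y => pd i f y) x

/-- Kronecker delta. -/
def kron (i j : Fin 3) : ℝ := if i = j then 1 else 0

/-- `|∇n|² = Σ_{i,k} (∂_k n_i)²`. -/
def gradSq (n : (Fin 3 → ℝ) → Fin 3 → ℝ) (x : Fin 3 → ℝ) : ℝ :=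
  ∑ i : Fin 3, ∑ k : Fin 3, (pd k (fun y => n y i) x) ^ 2

/-- `tr(Q²)`. -/
def trQ2 (Q : (Fin 3 → ℝ) → Fin 3 → Fin 3 → ℝ) (x : Fin 3 → ℝ) : ℝ :=
  ∑ k : Fin 3, ∑ l : Fin 3, Q x k l * Q x l k

/-- The one-constant Landau–de Gennes Euler–Lagrange equations on Ω. -/
def LdG_EL (t : ℝ) (Ω : Set (Fin 3 → ℝ)) (Q : (Fin 3 → ℝ) → Fin 3 → Fin 3 → ℝ) : Prop :=
  ∀ x ∈ Ω, ∀ i j : Fin 3,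
    lap (fun y => Q y i j) x =
      t * Q x i j
        - 3 * Real.sqrt 6 * ((∑ k : Fin 3, Q x i k * Q x k j) - (1/3) * kron i j * trQ2 Q x)
        + 2 * Q x i j * trQ2 Q x

/-- The uniaxial tensor `Q = s (n ⊗ n − I/3)`. -/
def uniQ (s : (Fin 3 → ℝ) → ℝ) (n : (Fin 3 → ℝ) → Fin 3 → ℝ) :
    (Fin 3 → ℝ) → Fin 3 → Fin 3 → ℝ :=
  fun x i j => s x * (n x i * n x j - kron i j / 3)

theorem pd_congr {f g : (Fin 3 → ℝ) → ℝ} {x : Fin 3 → ℝ} (h : f =ᶠ[nhds x] g) (k : Fin 3) :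
    pd k f x = pd k g x := by
  simp only [pd, h.fderiv_eq]

theorem pd_add {f g : (Fin 3 → ℝ) → ℝ} {x : Fin 3 → ℝ} (hf : DifferentiableAt ℝ f x)
    (hg : DifferentiableAt ℝ g x) (k : Fin 3) :
    pd k (fun y => f y + g y) x = pd k f x + pd k g x := by
  simp [pd, fderiv_fun_add hf hg]

theorem pd_mul {f g : (Fin 3 → ℝ) → ℝ} {x : Fin 3 → ℝ} (hf : DifferentiableAt ℝ f x)
    (hg : DifferentiableAt ℝ g x) (k : Fin 3) :
    pd k (fun y => f y * g y) x = pd k f x * g x + f x * pd k g x := by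
  simp only [pd, fderiv_fun_mul hf hg, add_apply,
    smul_apply, smul_eq_mul]
  ring

theorem pd_sub_const (f : (Fin 3 → ℝ) → ℝ) (c : ℝ) (k : Fin 3) (x : Fin 3 → ℝ) :
    pd k (fun y => f y - c) x = pd k f x := by
  simp [pd, fderiv_sub_const]

theorem pd_const (c : ℝ) (k : Fin 3) (x : Fin 3 → ℝ) : pd k (fun _ => c) x = 0 := by
  simp [pd]

theorem lap_congr {f g : (Fin 3 → ℝ) → ℝ} {x : Fin 3 → ℝ} (h : f =ᶠ[nhds x] g) :
    lap f x = lap g x :=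
  Finset.sum_congr rfl fun k _ =>
    pd_congr (h.eventuallyEq_nhds.mono fun _ hy => pd_congr hy k) k

theorem lap_sub_const (f : (Fin 3 → ℝ) → ℝ) (c : ℝ) (x : Fin 3 → ℝ) :
    lap (fun y => f y - c) x = lap f x := by
  simp only [lap, pd_sub_const]

theorem lap_const (c : ℝ) (x : Fin 3 → ℝ) : lap (fun _ => c) x = 0 := by
  simp [lap, pd_const]

theorem eventually_differentiableAt {f : (Fin 3 → ℝ) → ℝ} {x : Fin 3 → ℝ}
    (hf : ContDiffAt ℝ 2 f x) : ∀ᶠ y in nhds x, DifferentiableAt ℝ f y :=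
  (hf.eventually (by simp)).mono fun _ h => h.differentiableAt (by simp)

theorem differentiableAt_pd {f : (Fin 3 → ℝ) → ℝ} {x : Fin 3 → ℝ}
    (hf : ContDiffAt ℝ 2 f x) (k : Fin 3) : DifferentiableAt ℝ (fun y => pd k f y) x :=
  ((hf.fderiv_right (m := 1) (by norm_num)).differentiableAt (by simp)).clm_apply
    (differentiableAt_const _)

theorem lap_add {f g : (Fin 3 → ℝ) → ℝ} {x : Fin 3 → ℝ} (hf : ContDiffAt ℝ 2 f x)
    (hg : ContDiffAt ℝ 2 g x) : lap (fun y => f y + g y) x = lap f x + lap g x := by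
  simp only [lap, ← Finset.sum_add_distrib]
  refine Finset.sum_congr rfl fun k _ => ?_
  rw [← pd_add (differentiableAt_pd hf k) (differentiableAt_pd hg k)]
  apply pd_congr
  filter_upwards [eventually_differentiableAt hf, eventually_differentiableAt hg] with y h₁ h₂
  exact pd_add h₁ h₂ k

theorem lap_mul {f g : (Fin 3 → ℝ) → ℝ} {x : Fin 3 → ℝ} (hf : ContDiffAt ℝ 2 f x)
    (hg : ContDiffAt ℝ 2 g x) :
    lap (fun y => f y * g y) x =
      lap f x * g x + 2 * (∑ k : Fin 3, pd k f x * pd k g x) + f x * lap g x := by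
  simp only [lap, Finset.sum_mul, Finset.mul_sum, ← Finset.sum_add_distrib]
  refine Finset.sum_congr rfl fun k _ => ?_
  have hf₁ := hf.differentiableAt (by simp)
  have hg₁ := hg.differentiableAt (by simp)
  have hf₂ := differentiableAt_pd hf k
  have hg₂ := differentiableAt_pd hg k
  have h : (fun y => pd k (fun z => f z * g z) y) =ᶠ[nhds x]
      fun y => pd k f y * g y + f y * pd k g y := by
    filter_upwards [eventually_differentiableAt hf, eventually_differentiableAt hg] with y h₁ h₂
    exact pd_mul h₁ h₂ k
  rw [pd_congr h, pd_add (hf₂.fun_mul hg₁) (hf₁.fun_mul hg₂), pd_mul hf₂ hg₁, pd_mul hf₁ hg₂]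
  ring

/-- A unit vector field is orthogonal to its partial derivatives. -/
theorem sum_mul_pd_eq_zero {n : (Fin 3 → ℝ) → Fin 3 → ℝ} {x : Fin 3 → ℝ}
    (hn : ∀ i, ContDiffAt ℝ 2 (fun y => n y i) x)
    (hunit : ∀ᶠ y in nhds x, ∑ i : Fin 3, n y i ^ 2 = 1) (k : Fin 3) :
    ∑ i : Fin 3, n x i * pd k (fun y => n y i) x = 0 := by
  have hd := fun i => (hn i).differentiableAt (by simp)
  have h : (fun y => n y 0 * n y 0 + n y 1 * n y 1 + n y 2 * n y 2) =ᶠ[nhds x] fun _ => 1 := by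
    filter_upwards [hunit] with y hy
    simpa [Fin.sum_univ_three, sq] using hy
  have h' := pd_congr h k
  rw [pd_const, pd_add (((hd 0).fun_mul (hd 0)).fun_add ((hd 1).fun_mul (hd 1))) ((hd 2).fun_mul (hd 2)),
    pd_add ((hd 0).fun_mul (hd 0)) ((hd 1).fun_mul (hd 1)), pd_mul (hd 0) (hd 0),
    pd_mul (hd 1) (hd 1), pd_mul (hd 2) (hd 2)] at h'
  rw [Fin.sum_univ_three]
  linarith

theorem sum_mul_lap_eq_neg_gradSq {n : (Fin 3 → ℝ) → Fin 3 → ℝ} {x : Fin 3 → ℝ}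
    (hn : ∀ i, ContDiffAt ℝ 2 (fun y => n y i) x)
    (hunit : ∀ᶠ y in nhds x, ∑ i : Fin 3, n y i ^ 2 = 1) :
    ∑ i : Fin 3, n x i * lap (fun y => n y i) x = -gradSq n x := by
  have h : (fun y => n y 0 * n y 0 + n y 1 * n y 1 + n y 2 * n y 2) =ᶠ[nhds x] fun _ => 1 := by
    filter_upwards [hunit] with y hy
    simpa [Fin.sum_univ_three, sq] using hy
  have h' := lap_congr h
  rw [lap_const, lap_add (((hn 0).mul (hn 0)).add ((hn 1).mul (hn 1))) ((hn 2).mul (hn 2)),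
    lap_add ((hn 0).mul (hn 0)) ((hn 1).mul (hn 1)), lap_mul (hn 0) (hn 0),
    lap_mul (hn 1) (hn 1), lap_mul (hn 2) (hn 2)] at h'
  simp only [gradSq, Fin.sum_univ_three] at h' ⊢
  linarith

/-- The Landau–de Gennes nonlinearity at `s (n ⊗ n − I/3)` is a multiple of `n ⊗ n − I/3`. -/
theorem bulk_uniQ (t : ℝ) (s : (Fin 3 → ℝ) → ℝ) (n : (Fin 3 → ℝ) → Fin 3 → ℝ)
    {x : Fin 3 → ℝ} (hunit : ∑ i : Fin 3, n x i ^ 2 = 1) (i j : Fin 3) :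
    t * uniQ s n x i j
        - 3 * Real.sqrt 6 * ((∑ k : Fin 3, uniQ s n x i k * uniQ s n x k j)
          - (1/3) * kron i j * trQ2 (uniQ s n) x)
        + 2 * uniQ s n x i j * trQ2 (uniQ s n) x =
      (t * s x - Real.sqrt 6 * s x ^ 2 + (4/3) * s x ^ 3) * (n x i * n x j - kron i j / 3) := by
  have hsq : ∀ i j : Fin 3, ∑ k : Fin 3, uniQ s n x i k * uniQ s n x k j =
      s x ^ 2 * (n x i * n x j / 3 + kron i j / 9) := by
    intro i j
    have e : ∑ k : Fin 3, uniQ s n x i k * uniQ s n x k j =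
        s x ^ 2 * (n x i * n x j * (∑ k : Fin 3, n x k ^ 2) - 2 * (n x i * n x j) / 3
          + kron i j / 9) := by
      fin_cases i <;> fin_cases j <;> simp [uniQ, kron, Fin.sum_univ_three] <;> ring
    rw [e, hunit]
    ring
  have htr : trQ2 (uniQ s n) x = 2 / 3 * s x ^ 2 := by
    simp only [trQ2, hsq]
    rw [← Finset.mul_sum, Finset.sum_add_distrib, ← Finset.sum_div]
    simp only [← sq, hunit]
    simp [kron]
    ring
  rw [hsq, htr]
  simp only [uniQ]
  ring

theorem lap_uniQ {s : (Fin 3 → ℝ) → ℝ} {n : (Fin 3 → ℝ) → Fin 3 → ℝ} {x : Fin 3 → ℝ}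
    (hs : ContDiffAt ℝ 2 s x) (hn : ∀ i, ContDiffAt ℝ 2 (fun y => n y i) x) (i j : Fin 3) :
    lap (fun y => uniQ s n y i j) x =
      lap s x * (n x i * n x j - kron i j / 3)
        + (s x * lap (fun y => n y i) x
            + 2 * (∑ k : Fin 3, pd k s x * pd k (fun y => n y i) x)) * n x j
        + n x i * (s x * lap (fun y => n y j) x
            + 2 * (∑ k : Fin 3, pd k s x * pd k (fun y => n y j) x))
        + 2 * s x * (∑ k : Fin 3, pd k (fun y => n y i) x * pd k (fun y => n y j) x) := by
  simp only [uniQ]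
  rw [lap_mul hs (((hn i).mul (hn j)).sub contDiffAt_const), lap_sub_const,
    lap_mul (hn i) (hn j)]
  simp only [pd_sub_const,
    pd_mul ((hn i).differentiableAt (by simp)) ((hn j).differentiableAt (by simp)),
    Fin.sum_univ_three]
  ring

/-- The algebraic content of the uniaxial equations: `A` is the residual of the scalar equation,
`v = s Δn + 2 (∇s·∇) n`, `M = Σ_k ∂_k n ⊗ ∂_k n` and `g = |∇n|²`. -/
theorem uniaxial_split {A s g : ℝ} {n v : Fin 3 → ℝ} {M : Fin 3 → Fin 3 → ℝ}
    (hunit : ∑ i, n i ^ 2 = 1) (hv : ∑ i, n i * v i = -(s * g))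
    (hM : ∀ i, ∑ j, M i j * n j = 0)
    (h : ∀ i j, A * (n i * n j - kron i j / 3) + v i * n j + n i * v j + 2 * s * M i j = 0) :
    A = 3 * g * s ∧ (∀ i, v i + s * g * n i = 0) ∧
      ∀ i j, s * (2 * M i j + g * (n i * n j - kron i j)) = 0 := by
  have hc : ∀ i, 2 / 3 * A * n i + v i - s * g * n i = 0 := by
    intro i
    have hk : ∑ j, kron i j * n j = n i := by simp [kron]
    have hsum : ∑ j, (A * (n i * n j - kron i j / 3) + v i * n j + n i * v j
        + 2 * s * M i j) * n j = 0 := by simp [h]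
    have e : ∑ j, (A * (n i * n j - kron i j / 3) + v i * n j + n i * v j
        + 2 * s * M i j) * n j =
        A * n i * (∑ j, n j ^ 2) - A / 3 * (∑ j, kron i j * n j) + v i * (∑ j, n j ^ 2)
          + n i * (∑ j, n j * v j) + 2 * s * (∑ j, M i j * n j) := by
      simp only [Fin.sum_univ_three]
      ring
    rw [e, hk, hunit, hv, hM] at hsum
    linarith
  have hA : A = 3 * g * s := by
    have hsum : ∑ i, n i * (2 / 3 * A * n i + v i - s * g * n i) = 0 := by simp [hc]
    have e : ∑ i, n i * (2 / 3 * A * n i + v i - s * g * n i) =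
        (2 / 3 * A - s * g) * (∑ i, n i ^ 2) + ∑ i, n i * v i := by
      simp only [Fin.sum_univ_three]
      ring
    rw [e, hunit, hv] at hsum
    linarith
  have hv' : ∀ i, v i + s * g * n i = 0 := fun i => by
    have := hc i
    rw [hA] at this
    linarith
  refine ⟨hA, hv', fun i j => ?_⟩
  have := h i j
  rw [hA] at this
  linear_combination this - n j * hv' i - n i * hv' j

/-- if `Q = s (n⊗n − I/3)` solves the one-constant LdG Euler–Lagrange
equations on an open set Ω, with `s` smooth and `n` a smooth unit-vector field, then
`s` and `n` satisfy the coupled system (i)–(ii) on Ω, and at every point where `s ≠ 0`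
the director `n` satisfies the extra equation (iii). -/
theorem stmt0 (t : ℝ) (Ω : Set (Fin 3 → ℝ)) (hΩ : IsOpen Ω)
    (s : (Fin 3 → ℝ) → ℝ) (n : (Fin 3 → ℝ) → Fin 3 → ℝ)
    (hs : ContDiffOn ℝ (⊤ : ℕ∞) s Ω)
    (hn : ContDiffOn ℝ (⊤ : ℕ∞) n Ω)
    (hunit : ∀ x ∈ Ω, ∑ i : Fin 3, n x i ^ 2 = 1)
    (hEL : LdG_EL t Ω (uniQ s n)) :
    ∀ x ∈ Ω,
      (lap s x = 3 * gradSq n x * s x + t * s x - Real.sqrt 6 * s x ^ 2 + (4/3) * s x ^ 3)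
      ∧ (∀ i : Fin 3,
          s x * lap (fun y => n y i) x
            + 2 * (∑ k : Fin 3, pd k s x * pd k (fun y => n y i) x)
            + s x * gradSq n x * n x i = 0)
      ∧ (s x ≠ 0 → ∀ i j : Fin 3,
          2 * (∑ k : Fin 3, pd k (fun y => n y i) x * pd k (fun y => n y j) x)
            + gradSq n x * (n x i * n x j - kron i j) = 0) := by
  intro x hx
  have hΩx : Ω ∈ nhds x := hΩ.mem_nhds hx
  have hs₂ : ContDiffAt ℝ 2 s x := (hs.contDiffAt hΩx).of_le (WithTop.coe_le_coe.2 (le_top : (2 : ℕ∞) ≤ ⊤))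
  have hn₂ : ∀ i, ContDiffAt ℝ 2 (fun y => n y i) x :=
    contDiffAt_pi.1 ((hn.contDiffAt hΩx).of_le (WithTop.coe_le_coe.2 (le_top : (2 : ℕ∞) ≤ ⊤)))
  have hu : ∀ᶠ y in nhds x, ∑ i : Fin 3, n y i ^ 2 = 1 := Filter.eventually_of_mem hΩx hunit
  have horth := sum_mul_pd_eq_zero hn₂ hu
  have hlap := sum_mul_lap_eq_neg_gradSq hn₂ hu
  obtain ⟨h₁, h₂, h₃⟩ := uniaxial_split
    (A := lap s x - (t * s x - Real.sqrt 6 * s x ^ 2 + (4/3) * s x ^ 3))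
    (s := s x) (g := gradSq n x) (n := n x)
    (v := fun i => s x * lap (fun y => n y i) x
      + 2 * (∑ k : Fin 3, pd k s x * pd k (fun y => n y i) x))
    (M := fun i j => ∑ k : Fin 3, pd k (fun y => n y i) x * pd k (fun y => n y j) x)
    (hunit x hx)
    (by
      have h0 := horth 0
      have h1 := horth 1
      have h2 := horth 2
      simp only [Fin.sum_univ_three] at h0 h1 h2 hlap ⊢
      linear_combination s x * hlap + 2 * pd 0 s x * h0 + 2 * pd 1 s x * h1 + 2 * pd 2 s x * h2)
    (fun i => by
      have h0 := horth 0
      have h1 := horth 1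
      have h2 := horth 2
      simp only [Fin.sum_univ_three] at h0 h1 h2 ⊢
      linear_combination pd 0 (fun y => n y i) x * h0 + pd 1 (fun y => n y i) x * h1
        + pd 2 (fun y => n y i) x * h2)
    (fun i j => by
      have h := hEL x hx i j
      rw [bulk_uniQ t s n (hunit x hx), lap_uniQ hs₂ hn₂] at h
      linear_combination h)
  exact ⟨by linarith, h₂, fun hsx i j => (mul_eq_zero.1 (h₃ i j)).resolve_left hsx⟩

end
end

section
/- Let Ω ⊆ ℝ³ be open and f, g : Ω → ℝ smooth, and let n = (sin f cos g, sin f sin g, cos f), m = (cos f cos g, cos f sin g, − sin f), p = (− sin g, cos g, 0). Then pointwise on Ω: (i) |∇n|² = |∇f|² + |∇g|² sin² f, and (ii) 2 Σ_{k=1}^{3} ∂_k n ⊗ ∂_k n + |∇n|² (n ⊗ n − I) = (|∇f|² − |∇g|² sin² f)(m⊗m − p⊗p) + 4 (∇f·∇g) sin f (m⊙p). Consequently, n satisfies the extra equation at a point of Ω if and only if |∇f|² = |∇g|² sin² f and ∇f·∇g = 0 at that point. -/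
open Real Set

noncomputable section

/-- The director `n = (sin f cos g, sin f sin g, cos f)`. -/
def nDir (f g : (Fin 3 → ℝ) → ℝ) (x : Fin 3 → ℝ) : Fin 3 → ℝ :=
  ![Real.sin (f x) * Real.cos (g x), Real.sin (f x) * Real.sin (g x), Real.cos (f x)]

/-- `m = (cos f cos g, cos f sin g, − sin f)`. -/
def mDir (f g : (Fin 3 → ℝ) → ℝ) (x : Fin 3 → ℝ) : Fin 3 → ℝ :=
  ![Real.cos (f x) * Real.cos (g x), Real.cos (f x) * Real.sin (g x), - Real.sin (f x)]

/-- `p = (− sin g, cos g, 0)`. -/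
def pDir (g : (Fin 3 → ℝ) → ℝ) (x : Fin 3 → ℝ) : Fin 3 → ℝ :=
  ![- Real.sin (g x), Real.cos (g x), 0]

/-- Symmetrized tensor product `(u⊙v)_ij = (u_i v_j + u_j v_i)/2`. -/
def symProd (u v : Fin 3 → ℝ) (i j : Fin 3) : ℝ := (u i * v j + u j * v i) / 2

theorem pd_nDir {f g : (Fin 3 → ℝ) → ℝ} {x : Fin 3 → ℝ} (hf : DifferentiableAt ℝ f x)
    (hg : DifferentiableAt ℝ g x) (i k : Fin 3) :
    pd k (fun y => nDir f g y i) x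
      = mDir f g x i * pd k f x + Real.sin (f x) * pDir g x i * pd k g x := by
  have hf' := hf.hasFDerivAt
  have hg' := hg.hasFDerivAt
  fin_cases i
  · simp [pd, nDir, mDir, pDir, (hf'.sin.fun_mul hg'.cos).fderiv]
    ring
  · simp [pd, nDir, mDir, pDir, (hf'.sin.fun_mul hg'.sin).fderiv]
    ring
  · simp [pd, nDir, mDir, pDir, hf'.cos.fderiv]

theorem sum_mDir_sq (f g : (Fin 3 → ℝ) → ℝ) (x : Fin 3 → ℝ) : ∑ i, mDir f g x i ^ 2 = 1 := by
  simp only [mDir, Fin.sum_univ_three, Matrix.cons_val]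
  linear_combination Real.sin_sq_add_cos_sq (f x)
    + Real.cos (f x) ^ 2 * Real.sin_sq_add_cos_sq (g x)

theorem sum_pDir_sq (g : (Fin 3 → ℝ) → ℝ) (x : Fin 3 → ℝ) : ∑ i, pDir g x i ^ 2 = 1 := by
  simp only [pDir, Fin.sum_univ_three, Matrix.cons_val]
  linear_combination Real.sin_sq_add_cos_sq (g x)

theorem sum_mDir_mul_pDir (f g : (Fin 3 → ℝ) → ℝ) (x : Fin 3 → ℝ) :
    ∑ i, mDir f g x i * pDir g x i = 0 := by
  simp only [mDir, pDir, Fin.sum_univ_three, Matrix.cons_val]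
  ring

/-- Completeness of the orthonormal frame `n`, `m`, `p`. -/
theorem kron_eq_frame (f g : (Fin 3 → ℝ) → ℝ) (x : Fin 3 → ℝ) (i j : Fin 3) :
    kron i j = nDir f g x i * nDir f g x j + mDir f g x i * mDir f g x j
      + pDir g x i * pDir g x j := by
  have hF := Real.sin_sq_add_cos_sq (f x)
  have hG := Real.sin_sq_add_cos_sq (g x)
  fin_cases i <;> fin_cases j <;> simp [kron, nDir, mDir, pDir] <;> grind

theorem gradSq_nDir {f g : (Fin 3 → ℝ) → ℝ} {x : Fin 3 → ℝ} (hf : DifferentiableAt ℝ f x)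
    (hg : DifferentiableAt ℝ g x) :
    gradSq (nDir f g) x
      = (∑ k : Fin 3, (pd k f x) ^ 2)
        + (∑ k : Fin 3, (pd k g x) ^ 2) * Real.sin (f x) ^ 2 := by
  have hm := sum_mDir_sq f g x
  have hp := sum_pDir_sq g x
  have hmp := sum_mDir_mul_pDir f g x
  simp only [gradSq, pd_nDir hf hg]
  simp only [Fin.sum_univ_three] at *
  linear_combination (pd 0 f x ^ 2 + pd 1 f x ^ 2 + pd 2 f x ^ 2) * hm
    + (pd 0 g x ^ 2 + pd 1 g x ^ 2 + pd 2 g x ^ 2) * Real.sin (f x) ^ 2 * hp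
    + 2 * Real.sin (f x) * (pd 0 f x * pd 0 g x + pd 1 f x * pd 1 g x + pd 2 f x * pd 2 g x) * hmp

theorem extraEquation_lhs_nDir {f g : (Fin 3 → ℝ) → ℝ} {x : Fin 3 → ℝ}
    (hf : DifferentiableAt ℝ f x) (hg : DifferentiableAt ℝ g x) (i j : Fin 3) :
    2 * (∑ k : Fin 3,
          pd k (fun y => nDir f g y i) x * pd k (fun y => nDir f g y j) x)
        + gradSq (nDir f g) x * (nDir f g x i * nDir f g x j - kron i j)
      = ((∑ k : Fin 3, (pd k f x) ^ 2)
            - (∑ k : Fin 3, (pd k g x) ^ 2) * Real.sin (f x) ^ 2)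
          * (mDir f g x i * mDir f g x j - pDir g x i * pDir g x j)
        + 4 * (∑ k : Fin 3, pd k f x * pd k g x) * Real.sin (f x)
          * symProd (mDir f g x) (pDir g x) i j := by
  simp only [gradSq_nDir hf hg, pd_nDir hf hg, kron_eq_frame f g x, symProd, Fin.sum_univ_three]
  ring

/-- For orthonormal `u`, `v`, the tensors `u⊗u − v⊗v` and `u⊙v` are linearly independent. -/
theorem tensor_combination_eq_zero_iff {u v : Fin 3 → ℝ} (hu : ∑ i, u i ^ 2 = 1)
    (hv : ∑ i, v i ^ 2 = 1) (huv : ∑ i, u i * v i = 0) (a b : ℝ) :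
    (∀ i j, a * (u i * u j - v i * v j) + b * symProd u v i j = 0) ↔ a = 0 ∧ b = 0 := by
  refine ⟨fun h => ?_, fun ⟨ha, hb⟩ i j => by simp [ha, hb]⟩
  have contract (w z : Fin 3 → ℝ) : a * ((∑ i, u i * w i) * (∑ j, u j * z j)
      - (∑ i, v i * w i) * (∑ j, v j * z j))
      + b * ((∑ i, u i * w i) * (∑ j, v j * z j)
      + (∑ i, v i * w i) * (∑ j, u j * z j)) / 2 = 0 := by
    have hs : ∑ i, ∑ j, (a * (u i * u j - v i * v j) + b * symProd u v i j) * (w i * z j) = 0 := by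
      simp [h]
    rw [← hs]
    simp only [symProd, Fin.sum_univ_three]
    ring
  have hvu : ∑ i, v i * u i = 0 := by simpa only [mul_comm] using huv
  simp only [pow_two] at hu hv
  have huu := contract u u
  have huv' := contract u v
  rw [hu, hvu] at huu huv'
  rw [hv, huv] at huv'
  constructor <;> linarith

/-- for `n = (sin f cos g, sin f sin g, cos f)` one has
(i) `|∇n|² = |∇f|² + |∇g|² sin² f`,
(ii) the tensor identity
`2 Σ_k ∂_k n ⊗ ∂_k n + |∇n|² (n⊗n − I) = (|∇f|² − |∇g|² sin²f)(m⊗m − p⊗p) + 4(∇f·∇g) sin f (m⊙p)`,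
and (iii) `n` satisfies the extra equation at a point iff
`|∇f|² = |∇g|² sin² f` and `∇f·∇g = 0` there. -/
theorem stmt1 (Ω : Set (Fin 3 → ℝ)) (hΩ : IsOpen Ω) (f g : (Fin 3 → ℝ) → ℝ)
    (hf : ContDiffOn ℝ (⊤ : ℕ∞) f Ω) (hg : ContDiffOn ℝ (⊤ : ℕ∞) g Ω) :
    ∀ x ∈ Ω,
      (gradSq (nDir f g) x
          = (∑ k : Fin 3, (pd k f x) ^ 2)
            + (∑ k : Fin 3, (pd k g x) ^ 2) * Real.sin (f x) ^ 2)
      ∧ (∀ i j : Fin 3,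
          2 * (∑ k : Fin 3,
                pd k (fun y => nDir f g y i) x * pd k (fun y => nDir f g y j) x)
              + gradSq (nDir f g) x * (nDir f g x i * nDir f g x j - kron i j)
            = ((∑ k : Fin 3, (pd k f x) ^ 2)
                  - (∑ k : Fin 3, (pd k g x) ^ 2) * Real.sin (f x) ^ 2)
                * (mDir f g x i * mDir f g x j - pDir g x i * pDir g x j)
              + 4 * (∑ k : Fin 3, pd k f x * pd k g x) * Real.sin (f x)
                * symProd (mDir f g x) (pDir g x) i j)
      ∧ ((∀ i j : Fin 3,
            2 * (∑ k : Fin 3,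
                  pd k (fun y => nDir f g y i) x * pd k (fun y => nDir f g y j) x)
                + gradSq (nDir f g) x * (nDir f g x i * nDir f g x j - kron i j) = 0)
          ↔ ((∑ k : Fin 3, (pd k f x) ^ 2)
                = (∑ k : Fin 3, (pd k g x) ^ 2) * Real.sin (f x) ^ 2
              ∧ (∑ k : Fin 3, pd k f x * pd k g x) = 0)) := by
  intro x hx
  have hf' : DifferentiableAt ℝ f x :=
    (hf.contDiffAt (hΩ.mem_nhds hx)).differentiableAt (by simp)
  have hg' : DifferentiableAt ℝ g x :=
    (hg.contDiffAt (hΩ.mem_nhds hx)).differentiableAt (by simp)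
  refine ⟨gradSq_nDir hf' hg', extraEquation_lhs_nDir hf' hg', ?_⟩
  simp only [extraEquation_lhs_nDir hf' hg']
  rw [tensor_combination_eq_zero_iff (sum_mDir_sq f g x) (sum_pDir_sq g x)
    (sum_mDir_mul_pDir f g x), sub_eq_zero]
  refine and_congr_right fun h => ⟨fun hs => ?_, fun hs => by rw [hs]; ring⟩
  rcases mul_eq_zero.mp hs with hs | hs
  · linarith
  · -- Where `sin f` vanishes, the first equation forces `∇f = 0`.
    have hz : ∑ k : Fin 3, pd k f x ^ 2 = 0 := by rw [h, hs]; ring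
    rw [Finset.sum_eq_zero_iff_of_nonneg fun k _ => sq_nonneg _] at hz
    exact Finset.sum_eq_zero fun k hk => by
      rw [pow_eq_zero_iff two_ne_zero |>.mp (hz k hk), zero_mul]

end
end

section
/- Given smooth pairwise orthonormal unit-vector fields n, m, p : Ω → S² on an open set Ω ⊆ ℝ³ with n satisfying the extra equation, smooth scalar fields s, β, and Q = s (n⊗n − (1/3)I) + β (m⊗m − p⊗p), the following pointwise identities hold: tr(Q²) = (2/3) s² + 2 β², tr(Q³) = (2/9) s³ − 2 s β², and the Landau–de Gennes energy density satisfies (t/2) tr(Q²) − √6 tr(Q³) + (1/2)(tr(Q²))² + (1/2) |∇Q|² = (t/2)((2/3) s² + 2 β²) + √6 (2 β² − (2/9) s²) s + (2/9)(s² + 3 β²)² + (1/3) |∇s|² + |∇β|² + s² |∇n|² + β² (|∇n|² + 4 |(∇m)ᵀp|²). -/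
open Real Set

noncomputable section

/-- `Q = s (n⊗n − I/3) + β (m⊗m − p⊗p)`. -/
def biQ (s β : (Fin 3 → ℝ) → ℝ) (n m p : (Fin 3 → ℝ) → Fin 3 → ℝ)
    (x : Fin 3 → ℝ) (i j : Fin 3) : ℝ :=
  s x * (n x i * n x j - kron i j / 3) + β x * (m x i * m x j - p x i * p x j)

/-- `|(∇m)ᵀ p|²`, where `((∇m)ᵀp)_j = Σ_i (∂_j m_i) p_i`. -/
def gradMTp (m p : (Fin 3 → ℝ) → Fin 3 → ℝ) (x : Fin 3 → ℝ) : ℝ :=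
  ∑ j : Fin 3, (∑ i : Fin 3, pd j (fun y => m y i) x * p x i) ^ 2

/-- The matrix with columns `n`, `m`, `p`. -/
def frame (n m p : Fin 3 → ℝ) : Matrix (Fin 3) (Fin 3) ℝ :=
  Matrix.of fun i => ![n i, m i, p i]

open Matrix in
theorem frame_transpose_mul_self {n m p : Fin 3 → ℝ}
    (hnn : ∑ i, n i ^ 2 = 1) (hmm : ∑ i, m i ^ 2 = 1) (hpp : ∑ i, p i ^ 2 = 1)
    (hnm : ∑ i, n i * m i = 0) (hnp : ∑ i, n i * p i = 0) (hmp : ∑ i, m i * p i = 0) :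
    (frame n m p)ᵀ * frame n m p = 1 := by
  simp only [Fin.sum_univ_three] at hnn hmm hpp hnm hnp hmp
  ext i j
  fin_cases i <;> fin_cases j <;>
    simp [frame, Matrix.mul_apply, Fin.sum_univ_three] <;> linarith

theorem kron_eq_of_frame {n m p : Fin 3 → ℝ} (h : (frame n m p).transpose * frame n m p = 1)
    (i j : Fin 3) : kron i j = n i * n j + m i * m j + p i * p j := by
  have h' := Matrix.ext_iff.mpr (mul_eq_one_comm.mp h) i j
  simp only [frame, Matrix.mul_apply, Fin.sum_univ_three, Matrix.one_apply] at h'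
  simpa [kron] using h'.symm

/-- Expansion of a vector in an orthonormal frame. -/
theorem expand_of_frame {n m p : Fin 3 → ℝ} (h : (frame n m p).transpose * frame n m p = 1)
    (v : Fin 3 → ℝ) (i : Fin 3) :
    v i = (∑ j, v j * n j) * n i + (∑ j, v j * m j) * m i + (∑ j, v j * p j) * p i := by
  have hv : v i = ∑ j, kron i j * v j := by simp [kron]
  rw [hv]
  simp only [kron_eq_of_frame h, Fin.sum_univ_three]
  ring

open Matrix in
theorem sum_conj_sq {R : Matrix (Fin 3) (Fin 3) ℝ} (h : Rᵀ * R = 1)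
    (C : Matrix (Fin 3) (Fin 3) ℝ) :
    ∑ i, ∑ j, (R * C * Rᵀ) i j * (R * C * Rᵀ) j i = ∑ i, ∑ j, C i j * C j i := by
  have key : (R * C * Rᵀ * (R * C * Rᵀ)).trace = (C * C).trace := by
    have : R * C * Rᵀ * (R * C * Rᵀ) = R * (C * (Rᵀ * R) * C) * Rᵀ := by
      simp only [Matrix.mul_assoc]
    rw [this, Matrix.trace_mul_comm, ← Matrix.mul_assoc, h]
    simp
  simpa only [Matrix.trace, Matrix.diag, Matrix.mul_apply (M := R * C * Rᵀ),
    Matrix.mul_apply (M := C)] using key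

open Matrix in
theorem sum_conj_cube {R : Matrix (Fin 3) (Fin 3) ℝ} (h : Rᵀ * R = 1)
    (C : Matrix (Fin 3) (Fin 3) ℝ) :
    ∑ i, ∑ j, ∑ k, (R * C * Rᵀ) i j * (R * C * Rᵀ) j k * (R * C * Rᵀ) k i
      = ∑ i, ∑ j, ∑ k, C i j * C j k * C k i := by
  have trace_cube (A : Matrix (Fin 3) (Fin 3) ℝ) :
      ∑ i, ∑ j, ∑ k, A i j * A j k * A k i = (A * (A * A)).trace := by
    simp only [Matrix.trace, Matrix.diag, Matrix.mul_apply, Finset.mul_sum, mul_assoc]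
  have : R * C * Rᵀ * (R * C * Rᵀ * (R * C * Rᵀ))
      = R * (C * (Rᵀ * R) * C * (Rᵀ * R) * C) * Rᵀ := by
    simp only [Matrix.mul_assoc]
  rw [trace_cube, trace_cube, this, Matrix.trace_mul_comm, ← Matrix.mul_assoc, h]
  simp [Matrix.mul_assoc]

theorem biQ_eq_conj {n m p : (Fin 3 → ℝ) → Fin 3 → ℝ} {x : Fin 3 → ℝ}
    (h : (frame (n x) (m x) (p x)).transpose * frame (n x) (m x) (p x) = 1)
    (s β : (Fin 3 → ℝ) → ℝ) (i j : Fin 3) :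
    biQ s β n m p x i j = (frame (n x) (m x) (p x)
      * Matrix.diagonal ![2 / 3 * s x, -s x / 3 + β x, -s x / 3 - β x]
      * (frame (n x) (m x) (p x)).transpose) i j := by
  rw [biQ, kron_eq_of_frame h]
  simp [frame, Matrix.mul_apply, Fin.sum_univ_three, Matrix.diagonal_apply]
  ring

theorem pd_biQ {n m p : (Fin 3 → ℝ) → Fin 3 → ℝ} {s β : (Fin 3 → ℝ) → ℝ} {x : Fin 3 → ℝ}
    (hn : ∀ i, DifferentiableAt ℝ (fun y => n y i) x)
    (hm : ∀ i, DifferentiableAt ℝ (fun y => m y i) x)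
    (hp : ∀ i, DifferentiableAt ℝ (fun y => p y i) x)
    (hs : DifferentiableAt ℝ s x) (hβ : DifferentiableAt ℝ β x) (k i j : Fin 3) :
    pd k (fun y => biQ s β n m p y i j) x
      = pd k s x * (n x i * n x j - kron i j / 3)
        + s x * (pd k (fun y => n y i) x * n x j + n x i * pd k (fun y => n y j) x)
        + pd k β x * (m x i * m x j - p x i * p x j)
        + β x * (pd k (fun y => m y i) x * m x j + m x i * pd k (fun y => m y j) x
          - pd k (fun y => p y i) x * p x j - p x i * pd k (fun y => p y j) x) := by
  have h := (hs.hasFDerivAt.mul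
      (((hn i).hasFDerivAt.mul (hn j).hasFDerivAt).sub_const (kron i j / 3))).add
    (hβ.hasFDerivAt.mul (((hm i).hasFDerivAt.mul (hm j).hasFDerivAt).sub
      ((hp i).hasFDerivAt.mul (hp j).hasFDerivAt)))
  have h' : fderiv ℝ (fun y => biQ s β n m p y i j) x = _ := h.fderiv
  simp only [pd, h']
  simp
  ring

/-- Differentiating a constant pointwise inner product. -/
theorem pd_inner_of_const {Ω : Set (Fin 3 → ℝ)} (hΩ : IsOpen Ω) {x : Fin 3 → ℝ} (hx : x ∈ Ω)
    {u v : (Fin 3 → ℝ) → Fin 3 → ℝ} {c : ℝ}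
    (hu : ∀ i, DifferentiableAt ℝ (fun y => u y i) x)
    (hv : ∀ i, DifferentiableAt ℝ (fun y => v y i) x)
    (huv : ∀ y ∈ Ω, ∑ i, u y i * v y i = c) (k : Fin 3) :
    ∑ i, pd k (fun y => u y i) x * v x i + ∑ i, pd k (fun y => v y i) x * u x i = 0 := by
  have h := HasFDerivAt.fun_sum (u := Finset.univ)
    fun i _ => (hu i).hasFDerivAt.mul (hv i).hasFDerivAt
  have heq : (fun y => ∑ i, u y i * v y i) =ᶠ[nhds x] fun _ => c :=
    Filter.eventually_of_mem (hΩ.mem_nhds hx) huv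
  have h' := h.unique ((hasFDerivAt_const c x).congr_of_eventuallyEq heq)
  have h'' := congrArg (fun L => L (Pi.single k 1)) h'
  simp [Fin.sum_univ_three] at h''
  simp only [pd, Fin.sum_univ_three]
  linarith

/-- Under the extra equation, `2 Σ_k (∂_k n · e)² = |∇n|²` for every
unit vector `e` orthogonal to `n`. -/
theorem two_mul_sum_sq_of_extra {n : (Fin 3 → ℝ) → Fin 3 → ℝ} {x e : Fin 3 → ℝ}
    (hextra : ∀ i j : Fin 3,
      2 * (∑ k : Fin 3, pd k (fun y => n y i) x * pd k (fun y => n y j) x)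
        + gradSq n x * (n x i * n x j - kron i j) = 0)
    (hee : ∑ i, e i ^ 2 = 1) (hne : ∑ i, n x i * e i = 0) :
    2 * ∑ k, (∑ i, pd k (fun y => n y i) x * e i) ^ 2 = gradSq n x := by
  have h : ∑ i, ∑ j, e i * e j *
      (2 * (∑ k : Fin 3, pd k (fun y => n y i) x * pd k (fun y => n y j) x)
        + gradSq n x * (n x i * n x j - kron i j)) = 0 := by
    simp only [hextra, mul_zero, Finset.sum_const_zero]
  generalize gradSq n x = G at *
  simp only [Fin.sum_univ_three, kron] at h hee hne ⊢
  simp at h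
  linear_combination h + G * hee - G * (n x 0 * e 0 + n x 1 * e 1 + n x 2 * e 2) * hne

/-- The squared norm of `∂_k Q` in terms of the rotation coefficients of the frame. -/
theorem sum_pd_biQ_sq {n m p : (Fin 3 → ℝ) → Fin 3 → ℝ} {s β : (Fin 3 → ℝ) → ℝ}
    {Ω : Set (Fin 3 → ℝ)} (hΩ : IsOpen Ω) {x : Fin 3 → ℝ} (hx : x ∈ Ω)
    (hn : ∀ i, DifferentiableAt ℝ (fun y => n y i) x)
    (hm : ∀ i, DifferentiableAt ℝ (fun y => m y i) x)
    (hp : ∀ i, DifferentiableAt ℝ (fun y => p y i) x)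
    (hs : DifferentiableAt ℝ s x) (hβ : DifferentiableAt ℝ β x)
    (hnn : ∀ x ∈ Ω, ∑ i : Fin 3, n x i ^ 2 = 1)
    (hmm : ∀ x ∈ Ω, ∑ i : Fin 3, m x i ^ 2 = 1)
    (hpp : ∀ x ∈ Ω, ∑ i : Fin 3, p x i ^ 2 = 1)
    (hnm : ∀ x ∈ Ω, ∑ i : Fin 3, n x i * m x i = 0)
    (hnp : ∀ x ∈ Ω, ∑ i : Fin 3, n x i * p x i = 0)
    (hmp : ∀ x ∈ Ω, ∑ i : Fin 3, m x i * p x i = 0) (k : Fin 3) :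
    ∑ i, ∑ j, pd k (fun y => biQ s β n m p y i j) x ^ 2
      = 2 / 3 * pd k s x ^ 2 + 2 * pd k β x ^ 2
        + 2 * (s x - β x) ^ 2 * (∑ i, pd k (fun y => n y i) x * m x i) ^ 2
        + 2 * (s x + β x) ^ 2 * (∑ i, pd k (fun y => n y i) x * p x i) ^ 2
        + 8 * β x ^ 2 * (∑ i, pd k (fun y => m y i) x * p x i) ^ 2 := by
  have hR := frame_transpose_mul_self (hnn x hx) (hmm x hx) (hpp x hx) (hnm x hx) (hnp x hx)
    (hmp x hx)
  have dnn := pd_inner_of_const hΩ hx hn hn (by simpa only [sq] using hnn) k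
  have dmm := pd_inner_of_const hΩ hx hm hm (by simpa only [sq] using hmm) k
  have dpp := pd_inner_of_const hΩ hx hp hp (by simpa only [sq] using hpp) k
  have dnm := pd_inner_of_const hΩ hx hn hm hnm k
  have dnp := pd_inner_of_const hΩ hx hn hp hnp k
  have dmp := pd_inner_of_const hΩ hx hm hp hmp k
  have en := expand_of_frame hR (fun i => pd k (fun y => n y i) x)
  have em := expand_of_frame hR (fun i => pd k (fun y => m y i) x)
  have ep := expand_of_frame hR (fun i => pd k (fun y => p y i) x)
  beta_reduce at en em ep
  set a := ∑ i, pd k (fun y => n y i) x * m x i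
  set b := ∑ i, pd k (fun y => n y i) x * p x i
  set c := ∑ i, pd k (fun y => m y i) x * p x i
  rw [show ∑ i, pd k (fun y => n y i) x * n x i = 0 by linarith] at en
  rw [show ∑ i, pd k (fun y => m y i) x * m x i = 0 by linarith,
    show ∑ i, pd k (fun y => m y i) x * n x i = -a by linarith] at em
  rw [show ∑ i, pd k (fun y => p y i) x * p x i = 0 by linarith,
    show ∑ i, pd k (fun y => p y i) x * n x i = -b by linarith,
    show ∑ i, pd k (fun y => p y i) x * m x i = -c by linarith] at ep
  let C : Matrix (Fin 3) (Fin 3) ℝ :=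
    !![2 / 3 * pd k s x, (s x - β x) * a, (s x + β x) * b;
      (s x - β x) * a, -pd k s x / 3 + pd k β x, 2 * β x * c;
      (s x + β x) * b, 2 * β x * c, -pd k s x / 3 - pd k β x]
  have hC (i j : Fin 3) : pd k (fun y => biQ s β n m p y i j) x
      = (frame (n x) (m x) (p x) * C * (frame (n x) (m x) (p x)).transpose) i j := by
    rw [pd_biQ hn hm hp hs hβ, kron_eq_of_frame hR, en i, en j, em i, em j, ep i, ep j]
    simp [C, frame, Matrix.mul_apply, Fin.sum_univ_three]
    ring
  have hsymm (i j : Fin 3) : pd k (fun y => biQ s β n m p y i j) x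
      = pd k (fun y => biQ s β n m p y j i) x := by
    rw [pd_biQ hn hm hp hs hβ, pd_biQ hn hm hp hs hβ, kron_eq_of_frame hR, kron_eq_of_frame hR]
    ring
  calc _ = ∑ i, ∑ j, pd k (fun y => biQ s β n m p y i j) x
        * pd k (fun y => biQ s β n m p y j i) x :=
        Finset.sum_congr rfl fun i _ => Finset.sum_congr rfl fun j _ => by
          rw [sq, hsymm j i]
    _ = ∑ i, ∑ j, C i j * C j i := by simp only [hC, sum_conj_sq hR]
    _ = _ := by
      simp [C, Fin.sum_univ_three]
      ring

/-- for `Q = s(n⊗n − I/3) + β(m⊗m − p⊗p)` with `n, m, p` smooth pairwise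
orthonormal and `n` satisfying the extra equation, one has `tr(Q²) = (2/3)s² + 2β²`,
`tr(Q³) = (2/9)s³ − 2sβ²`, and the stated reduction of the LdG energy density. -/
theorem stmt10 (t : ℝ) (Ω : Set (Fin 3 → ℝ)) (hΩ : IsOpen Ω)
    (n m p : (Fin 3 → ℝ) → Fin 3 → ℝ) (s β : (Fin 3 → ℝ) → ℝ)
    (hn : ContDiffOn ℝ (⊤ : ℕ∞) n Ω)
    (hm : ContDiffOn ℝ (⊤ : ℕ∞) m Ω)
    (hp : ContDiffOn ℝ (⊤ : ℕ∞) p Ω)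
    (hs : ContDiffOn ℝ (⊤ : ℕ∞) s Ω)
    (hβ : ContDiffOn ℝ (⊤ : ℕ∞) β Ω)
    (hnn : ∀ x ∈ Ω, ∑ i : Fin 3, n x i ^ 2 = 1)
    (hmm : ∀ x ∈ Ω, ∑ i : Fin 3, m x i ^ 2 = 1)
    (hpp : ∀ x ∈ Ω, ∑ i : Fin 3, p x i ^ 2 = 1)
    (hnm : ∀ x ∈ Ω, ∑ i : Fin 3, n x i * m x i = 0)
    (hnp : ∀ x ∈ Ω, ∑ i : Fin 3, n x i * p x i = 0)
    (hmp : ∀ x ∈ Ω, ∑ i : Fin 3, m x i * p x i = 0)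
    (hextra : ∀ x ∈ Ω, ∀ i j : Fin 3,
      2 * (∑ k : Fin 3, pd k (fun y => n y i) x * pd k (fun y => n y j) x)
        + gradSq n x * (n x i * n x j - kron i j) = 0) :
    ∀ x ∈ Ω,
      (∑ i : Fin 3, ∑ j : Fin 3, biQ s β n m p x i j * biQ s β n m p x j i
          = (2/3) * s x ^ 2 + 2 * β x ^ 2)
      ∧ (∑ i : Fin 3, ∑ j : Fin 3, ∑ k : Fin 3,
            biQ s β n m p x i j * biQ s β n m p x j k * biQ s β n m p x k i
          = (2/9) * s x ^ 3 - 2 * s x * β x ^ 2)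
      ∧ ((t/2) * (∑ i : Fin 3, ∑ j : Fin 3, biQ s β n m p x i j * biQ s β n m p x j i)
            - Real.sqrt 6 * (∑ i : Fin 3, ∑ j : Fin 3, ∑ k : Fin 3,
                biQ s β n m p x i j * biQ s β n m p x j k * biQ s β n m p x k i)
            + (1/2) * (∑ i : Fin 3, ∑ j : Fin 3,
                biQ s β n m p x i j * biQ s β n m p x j i) ^ 2
            + (1/2) * (∑ i : Fin 3, ∑ j : Fin 3, ∑ k : Fin 3,
                (pd k (fun y => biQ s β n m p y i j) x) ^ 2)
          = (t/2) * ((2/3) * s x ^ 2 + 2 * β x ^ 2)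
            + Real.sqrt 6 * (2 * β x ^ 2 - (2/9) * s x ^ 2) * s x
            + (2/9) * (s x ^ 2 + 3 * β x ^ 2) ^ 2
            + (1/3) * (∑ k : Fin 3, (pd k s x) ^ 2)
            + (∑ k : Fin 3, (pd k β x) ^ 2)
            + s x ^ 2 * gradSq n x
            + β x ^ 2 * (gradSq n x + 4 * gradMTp m p x)) := by
  intro x hx
  have hΩx := hΩ.mem_nhds hx
  have hR := frame_transpose_mul_self (hnn x hx) (hmm x hx) (hpp x hx) (hnm x hx) (hnp x hx)
    (hmp x hx)
  have htr2 : ∑ i : Fin 3, ∑ j : Fin 3, biQ s β n m p x i j * biQ s β n m p x j i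
      = (2/3) * s x ^ 2 + 2 * β x ^ 2 := by
    simp only [biQ_eq_conj hR, sum_conj_sq hR]
    simp [Fin.sum_univ_three, Matrix.diagonal_apply]
    ring
  have htr3 : ∑ i : Fin 3, ∑ j : Fin 3, ∑ k : Fin 3,
        biQ s β n m p x i j * biQ s β n m p x j k * biQ s β n m p x k i
      = (2/9) * s x ^ 3 - 2 * s x * β x ^ 2 := by
    simp only [biQ_eq_conj hR, sum_conj_cube hR]
    simp [Fin.sum_univ_three, Matrix.diagonal_apply]
    ring
  refine ⟨htr2, htr3, ?_⟩
  have diff {E : Type} [NormedAddCommGroup E] [NormedSpace ℝ E] {f : (Fin 3 → ℝ) → E}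
      (hf : ContDiffOn ℝ (⊤ : ℕ∞) f Ω) : DifferentiableAt ℝ f x :=
    (hf.contDiffAt hΩx).differentiableAt (by simp)
  have hsum : ∑ i : Fin 3, ∑ j : Fin 3, ∑ k : Fin 3, (pd k (fun y => biQ s β n m p y i j) x) ^ 2
      = ∑ k : Fin 3, ∑ i : Fin 3, ∑ j : Fin 3, (pd k (fun y => biQ s β n m p y i j) x) ^ 2 := by
    rw [Finset.sum_comm]
    simp only [Fin.sum_univ_three]
    ring
  have hm2 := two_mul_sum_sq_of_extra (hextra x hx) (hmm x hx) (hnm x hx)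
  have hp2 := two_mul_sum_sq_of_extra (hextra x hx) (hpp x hx) (hnp x hx)
  rw [htr2, htr3, hsum]
  simp only [sum_pd_biQ_sq hΩ hx (differentiableAt_pi.mp (diff hn))
    (differentiableAt_pi.mp (diff hm)) (differentiableAt_pi.mp (diff hp)) (diff hs) (diff hβ)
    hnn hmm hpp hnm hnp hmp,
    Finset.sum_add_distrib, ← Finset.mul_sum, gradMTp]
  linear_combination (1/2) * (s x - β x) ^ 2 * hm2 + (1/2) * (s x + β x) ^ 2 * hp2

end
end

section
/- Let Ω ⊆ ℝ³ be a bounded open set, let n, m, p : Ω → S² be smooth pairwise orthonormal unit-vector fields, t ∈ ℝ, and define the reduced Landau–de Gennes energy F(s, β) = ∫_Ω [ (t/2)((2/3) s² + 2 β²) + √6 (2 β² − (2/9) s²) s + (2/9)(s² + 3 β²)² + (1/3) |∇s|² + |∇β|² + s² |∇n|² + β² (|∇n|² + 4 |(∇m)ᵀp|²) ] dx. Then for Lipschitz functions s, β : Ω → ℝ one has F(|s|, β) − F(s, β) = ∫_{Ω ∩ {s < 0}} 4√6 ((1/9) s³ − s β²) dx. In particular, if β² ≤ (1/9) s² on Ω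 with strict inequality at every point where s < 0, and the open set {x ∈ Ω : s(x) < 0} is nonempty, then F(|s|, β) < F(s, β); hence any global minimizer of F over a class containing both (s, β) and (|s|, β) must have s ≥ 0 in Ω. -/
open Real Set MeasureTheory

noncomputable section

/-- The reduced Landau–de Gennes energy density in the variables `(s, β)`. -/
def dens (t : ℝ) (n m p : (Fin 3 → ℝ) → Fin 3 → ℝ) (s β : (Fin 3 → ℝ) → ℝ)
    (x : Fin 3 → ℝ) : ℝ :=
  (t/2) * ((2/3) * s x ^ 2 + 2 * β x ^ 2)
    + Real.sqrt 6 * (2 * β x ^ 2 - (2/9) * s x ^ 2) * s x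
    + (2/9) * (s x ^ 2 + 3 * β x ^ 2) ^ 2
    + (1/3) * (∑ k : Fin 3, (pd k s x) ^ 2)
    + (∑ k : Fin 3, (pd k β x) ^ 2)
    + s x ^ 2 * gradSq n x
    + β x ^ 2 * (gradSq n x + 4 * gradMTp m p x)

/-- At a zero of `s`, differentiability of `|s|` forces `s` and `|s|` to have zero derivative. -/
theorem fderiv_abs_eq_of_eq_zero {E : Type*} [NormedAddCommGroup E] [NormedSpace ℝ E]
    {s : E → ℝ} {x : E} (hx : s x = 0) (hd : DifferentiableAt ℝ (fun y => |s y|) x) :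
    fderiv ℝ (fun y => |s y|) x = fderiv ℝ s x := by
  have hmin : IsLocalMin (fun y => |s y|) x :=
    Filter.Eventually.of_forall fun y => by simp [hx]
  have h0 := hmin.fderiv_eq_zero
  have h1 := hd.hasFDerivAt
  rw [h0] at h1
  have h2 : HasFDerivAt s (0 : E →L[ℝ] ℝ) x := by
    rw [hasFDerivAt_iff_isLittleO] at h1 ⊢
    rw [← Asymptotics.isLittleO_norm_left]
    simpa [hx] using h1
  rw [h0, h2.fderiv]

/-- The partial derivatives of `|s|` and `s` have the same squares wherever `s` is continuous,
provided `|s|` is differentiable where `s` vanishes. -/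
theorem pd_abs_sq {s : (Fin 3 → ℝ) → ℝ} {x : Fin 3 → ℝ} (hc : ContinuousAt s x)
    (hd : DifferentiableAt ℝ (fun y => |s y|) x) (k : Fin 3) :
    pd k (fun y => |s y|) x ^ 2 = pd k s x ^ 2 := by
  unfold pd
  rcases lt_trichotomy (s x) 0 with h | h | h
  · have : (fun y => |s y|) =ᶠ[nhds x] fun y => -s y :=
      (hc.eventually_lt_const h).mono fun y hy => abs_of_neg hy
    rw [this.fderiv_eq, fderiv_fun_neg]
    simp
  · rw [fderiv_abs_eq_of_eq_zero h hd]
  · have : (fun y => |s y|) =ᶠ[nhds x] s :=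
      (hc.eventually_const_lt h).mono fun y hy => abs_of_pos hy
    rw [this.fderiv_eq]

/-- Almost everywhere, the energy densities of `(|s|, β)` and `(s, β)` differ only through the
cubic term, and only where `s < 0`. -/
theorem ae_dens_abs_sub_dens (t : ℝ) {Ω : Set (Fin 3 → ℝ)} (hΩ : IsOpen Ω)
    (n m p : (Fin 3 → ℝ) → Fin 3 → ℝ) {s : (Fin 3 → ℝ) → ℝ} (β : (Fin 3 → ℝ) → ℝ)
    {K : NNReal} (hs : LipschitzOnWith K s Ω) :
    ∀ᵐ x ∂(volume.restrict Ω),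
      dens t n m p (fun y => |s y|) β x - dens t n m p s β x
        = (Ω ∩ {y | s y < 0}).indicator
            (fun x => 4 * Real.sqrt 6 * ((1/9) * s x ^ 3 - s x * β x ^ 2)) x := by
  have habs : LipschitzOnWith K (fun y => |s y|) Ω := by
    simpa [Function.comp_def] using lipschitzWith_one_norm.comp_lipschitzOnWith hs
  rw [ae_restrict_iff' hΩ.measurableSet]
  filter_upwards [habs.ae_differentiableWithinAt_of_mem (μ := volume)] with x hx hxΩ
  have hd := (hx hxΩ).differentiableAt (hΩ.mem_nhds hxΩ)
  have hpd := pd_abs_sq (hs.continuousOn.continuousAt (hΩ.mem_nhds hxΩ)) hd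
  simp only [dens, hpd, sq_abs]
  by_cases h : s x < 0
  · rw [indicator_of_mem (show x ∈ Ω ∩ {y | s y < 0} from ⟨hxΩ, h⟩), abs_of_neg h]
    ring
  · rw [indicator_of_notMem fun h' => h h'.2, abs_of_nonneg (not_lt.mp h)]
    ring

/-- for the reduced LdG energy `F(s,β) = ∫_Ω dens`, one has
`F(|s|,β) − F(s,β) = ∫_{Ω ∩ {s<0}} 4√6((1/9)s³ − sβ²)`. In particular, if `β² ≤ (1/9)s²`
on Ω with strict inequality where `s < 0`, and `{s < 0}` is nonempty, then
`F(|s|,β) < F(s,β)`; hence a global minimizer (so that `F(s,β) ≤ F(|s|,β)`) has `s ≥ 0`. -/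
theorem stmt11 (t : ℝ) (Ω : Set (Fin 3 → ℝ)) (hΩ : IsOpen Ω)
    (hΩbd : Bornology.IsBounded Ω)
    (n m p : (Fin 3 → ℝ) → Fin 3 → ℝ)
    (hn : ContDiffOn ℝ (⊤ : ℕ∞) n Ω)
    (hm : ContDiffOn ℝ (⊤ : ℕ∞) m Ω)
    (hp : ContDiffOn ℝ (⊤ : ℕ∞) p Ω)
    (hnn : ∀ x ∈ Ω, ∑ i : Fin 3, n x i ^ 2 = 1)
    (hmm : ∀ x ∈ Ω, ∑ i : Fin 3, m x i ^ 2 = 1)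
    (hpp : ∀ x ∈ Ω, ∑ i : Fin 3, p x i ^ 2 = 1)
    (hnm : ∀ x ∈ Ω, ∑ i : Fin 3, n x i * m x i = 0)
    (hnp : ∀ x ∈ Ω, ∑ i : Fin 3, n x i * p x i = 0)
    (hmp : ∀ x ∈ Ω, ∑ i : Fin 3, m x i * p x i = 0)
    (s β : (Fin 3 → ℝ) → ℝ)
    (hsLip : ∃ K : NNReal, LipschitzOnWith K s Ω)
    (hβLip : ∃ K : NNReal, LipschitzOnWith K β Ω)
    (hint1 : IntegrableOn (dens t n m p s β) Ω)
    (hint2 : IntegrableOn (dens t n m p (fun y => |s y|) β) Ω) :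
    ((∫ x in Ω, dens t n m p (fun y => |s y|) β x)
        - (∫ x in Ω, dens t n m p s β x)
      = ∫ x in Ω ∩ {y : Fin 3 → ℝ | s y < 0},
          4 * Real.sqrt 6 * ((1/9) * s x ^ 3 - s x * β x ^ 2))
    ∧ ((∀ x ∈ Ω, β x ^ 2 ≤ (1/9) * s x ^ 2) →
        (∀ x ∈ Ω, s x < 0 → β x ^ 2 < (1/9) * s x ^ 2) →
        ((Ω ∩ {y : Fin 3 → ℝ | s y < 0}).Nonempty →
            (∫ x in Ω, dens t n m p (fun y => |s y|) β x)
              < (∫ x in Ω, dens t n m p s β x))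
        ∧ ((∫ x in Ω, dens t n m p s β x)
              ≤ (∫ x in Ω, dens t n m p (fun y => |s y|) β x) →
            ∀ x ∈ Ω, 0 ≤ s x)) := by
  obtain ⟨K, hs⟩ := hsLip
  have hae := ae_dens_abs_sub_dens t hΩ n m p β hs
  have hU : IsOpen (Ω ∩ {y | s y < 0}) := hs.continuousOn.isOpen_inter_preimage hΩ isOpen_Iio
  have hUΩ : Ω ∩ (Ω ∩ {y | s y < 0}) = Ω ∩ {y | s y < 0} :=
    inter_eq_right.mpr inter_subset_left
  have hdiff : (∫ x in Ω, dens t n m p (fun y => |s y|) β x) - (∫ x in Ω, dens t n m p s β x)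
      = ∫ x in Ω ∩ {y | s y < 0}, 4 * Real.sqrt 6 * ((1/9) * s x ^ 3 - s x * β x ^ 2) := by
    rw [← integral_sub hint2 hint1, integral_congr_ae hae,
      setIntegral_indicator hU.measurableSet, hUΩ]
  have hintU : IntegrableOn
      (fun x => 4 * Real.sqrt 6 * ((1/9) * s x ^ 3 - s x * β x ^ 2)) (Ω ∩ {y | s y < 0}) := by
    have h := (integrable_congr hae).mp (hint2.sub hint1)
    rwa [integrable_indicator_iff hU.measurableSet, IntegrableOn,
      Measure.restrict_restrict hU.measurableSet, inter_comm, hUΩ] at h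
  refine ⟨hdiff, fun _ hlt => ?_⟩
  have hstrict : (Ω ∩ {y : Fin 3 → ℝ | s y < 0}).Nonempty →
      (∫ x in Ω, dens t n m p (fun y => |s y|) β x) < (∫ x in Ω, dens t n m p s β x) := by
    intro hne
    have hneg : ∀ x ∈ Ω ∩ {y | s y < 0},
        0 < -(4 * Real.sqrt 6 * ((1/9) * s x ^ 3 - s x * β x ^ 2)) := by
      rintro x ⟨hxΩ, hx : s x < 0⟩
      have h6 : 0 < 4 * Real.sqrt 6 := by positivity
      have := mul_pos h6 (mul_pos (neg_pos.mpr hx) (sub_pos.mpr (hlt x hxΩ hx)))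
      linarith
    have hpos : 0 < ∫ x in Ω ∩ {y | s y < 0},
        -(4 * Real.sqrt 6 * ((1/9) * s x ^ 3 - s x * β x ^ 2)) := by
      rw [setIntegral_pos_iff_support_of_nonneg_ae
        (ae_restrict_of_forall_mem hU.measurableSet fun x hx => (hneg x hx).le) hintU.neg,
        inter_eq_right.mpr fun x hx => Function.mem_support.mpr (hneg x hx).ne']
      exact hU.measure_pos volume hne
    rw [integral_neg] at hpos
    linarith
  refine ⟨hstrict, fun hle x hx => ?_⟩
  by_contra! h
  exact (hstrict ⟨x, hx, h⟩).not_ge hle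

end
end

section
/- Let Ω ⊆ ℝ³ be a bounded open set, t ≥ 0, and n, m, p : Ω → S² smooth pairwise orthonormal unit-vector fields. Suppose s, β ∈ C²(Ω) ∩ C(Ω̄) solve the reduced Euler–Lagrange system Δs = 3 |∇n|² s + t s − √6 s² + (4/3) s³ + 4 β² s + 3√6 β² and Δβ = (|∇n|² + 4 |(∇m)ᵀp|² + t + 2√6 s + (4/3) s²) β + 4 β³ on Ω, with s ≥ 0 in Ω and β = 0 on ∂Ω. Then β ≡ 0 in Ω; in particular Q = s (n⊗n − (1/3)I) + β (m⊗m − p⊗p) is purely uniaxial. -/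
open Real Set

noncomputable section

/-- At a local maximum a real function has nonpositive second derivative. -/
theorem IsLocalMax.deriv_deriv_nonpos {g : ℝ → ℝ} {a : ℝ} (h : IsLocalMax g a)
    (hc : ContinuousAt g a) : deriv (deriv g) a ≤ 0 := by
  by_contra! hpos
  have hmin := isLocalMin_of_deriv_deriv_pos hpos h.deriv_eq_zero hc
  have heq : g =ᶠ[nhds a] fun _ => g a := by
    filter_upwards [h, hmin] with y hy hy'
    exact le_antisymm hy hy'
  have hzero : deriv (deriv g) a = 0 := by
    rw [heq.deriv.deriv_eq]
    simp
  exact hpos.ne' hzero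

theorem pd_pd_nonpos_of_isLocalMax {f : (Fin 3 → ℝ) → ℝ} {x : Fin 3 → ℝ}
    (hf : ContDiffAt ℝ 2 f x) (hmax : IsLocalMax f x) (i : Fin 3) :
    pd i (fun y => pd i f y) x ≤ 0 := by
  set e : Fin 3 → ℝ := Pi.single i 1
  set l : ℝ → Fin 3 → ℝ := fun r => x + r • e with hl
  have hl0 : l 0 = x := by simp [hl]
  have hlc : ContinuousAt l 0 := by fun_prop
  have hld : ∀ r, HasDerivAt l e r := fun r => by
    simpa [hl] using ((hasDerivAt_id r).smul_const e).const_add x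
  have hlt : Filter.Tendsto l (nhds 0) (nhds x) := by simpa only [ContinuousAt, hl0] using hlc
  have hd : ∀ᶠ y in nhds x, DifferentiableAt ℝ f y := by
    filter_upwards [hf.eventually (by simp)] with y hy
    exact hy.differentiableAt (by norm_num)
  have hderiv : deriv (f ∘ l) =ᶠ[nhds 0] (fun y => pd i f y) ∘ l := by
    filter_upwards [hlt.eventually hd] with r hr
    exact (hr.hasFDerivAt.comp_hasDerivAt r (hld r)).deriv
  have hpd : DifferentiableAt ℝ (fun y => pd i f y) (l 0) := by
    rw [hl0]
    have h1 : DifferentiableAt ℝ (fderiv ℝ f) x :=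
      (hf.fderiv_right (m := 1) (by norm_num)).differentiableAt (by norm_num)
    exact h1.clm_apply (differentiableAt_const _)
  have hsecond : deriv (deriv (f ∘ l)) 0 = pd i (fun y => pd i f y) x := by
    rw [hderiv.deriv_eq, (hpd.hasFDerivAt.comp_hasDerivAt 0 (hld 0)).deriv, hl0]
    rfl
  rw [← hsecond]
  refine IsLocalMax.deriv_deriv_nonpos ?_ ?_
  · have h : ∀ᶠ r in nhds (0 : ℝ), f (l r) ≤ f x := hlt.eventually hmax
    simpa only [IsLocalMax, IsMaxFilter, Function.comp_apply, hl0] using h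
  · exact ContinuousAt.comp (by rw [hl0]; exact hf.continuousAt) hlc

theorem lap_nonpos_of_isLocalMax {f : (Fin 3 → ℝ) → ℝ} {x : Fin 3 → ℝ}
    (hf : ContDiffAt ℝ 2 f x) (hmax : IsLocalMax f x) : lap f x ≤ 0 :=
  Finset.sum_nonpos fun i _ => pd_pd_nonpos_of_isLocalMax hf hmax i

theorem lap_neg (f : (Fin 3 → ℝ) → ℝ) (x : Fin 3 → ℝ) : lap (-f) x = -lap f x := by
  have h (i : Fin 3) (g : (Fin 3 → ℝ) → ℝ) (y : Fin 3 → ℝ) :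
      pd i (fun z => -g z) y = -pd i g y := by
    simp [pd, fderiv_fun_neg]
  unfold lap
  rw [← Finset.sum_neg_distrib]
  refine Finset.sum_congr rfl fun i _ => ?_
  rw [← h]
  congr 1
  funext y
  exact h i f y

/-- Weak maximum principle: a function whose Laplacian is positive wherever the function is
positive, and which vanishes on the boundary, is nonpositive. -/
theorem nonpos_of_lap_pos {Ω : Set (Fin 3 → ℝ)} (hΩ : IsOpen Ω) (hΩbd : Bornology.IsBounded Ω)
    {f : (Fin 3 → ℝ) → ℝ} (hf : ContDiffOn ℝ 2 f Ω) (hfc : ContinuousOn f (closure Ω))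
    (hbdry : ∀ x ∈ frontier Ω, f x = 0) (hlap : ∀ x ∈ Ω, 0 < f x → 0 < lap f x) :
    ∀ x ∈ Ω, f x ≤ 0 := by
  intro x hx
  by_contra! hpos
  obtain ⟨z, hz, hzmax⟩ := hΩbd.isCompact_closure.exists_isMaxOn ⟨x, subset_closure hx⟩ hfc
  have hfz : 0 < f z := hpos.trans_le (hzmax (subset_closure hx))
  have hzΩ : z ∈ Ω := by
    by_contra hn
    exact hfz.ne' (hbdry z (hΩ.frontier_eq ▸ ⟨hz, hn⟩))
  have hnhds := hΩ.mem_nhds hzΩ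
  have hmax : IsLocalMax f z := by
    filter_upwards [hnhds] with y hy
    exact hzmax (subset_closure hy)
  exact (hlap z hzΩ hfz).not_ge (lap_nonpos_of_isLocalMax (hf.contDiffAt hnhds) hmax)

/-- let `Ω` be bounded open, `t ≥ 0`, and suppose `(s, β)` solves the
reduced Euler–Lagrange system with `s ≥ 0` in Ω and `β = 0` on `∂Ω`. Then `β ≡ 0` in Ω;
in particular `Q = s(n⊗n − I/3) + β(m⊗m − p⊗p)` is purely uniaxial. -/
theorem stmt12 (t : ℝ) (ht : 0 ≤ t) (Ω : Set (Fin 3 → ℝ)) (hΩ : IsOpen Ω)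
    (hΩbd : Bornology.IsBounded Ω)
    (n m p : (Fin 3 → ℝ) → Fin 3 → ℝ)
    (hn : ContDiffOn ℝ (⊤ : ℕ∞) n Ω)
    (hm : ContDiffOn ℝ (⊤ : ℕ∞) m Ω)
    (hp : ContDiffOn ℝ (⊤ : ℕ∞) p Ω)
    (hnn : ∀ x ∈ Ω, ∑ i : Fin 3, n x i ^ 2 = 1)
    (hmm : ∀ x ∈ Ω, ∑ i : Fin 3, m x i ^ 2 = 1)
    (hpp : ∀ x ∈ Ω, ∑ i : Fin 3, p x i ^ 2 = 1)
    (hnm : ∀ x ∈ Ω, ∑ i : Fin 3, n x i * m x i = 0)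
    (hnp : ∀ x ∈ Ω, ∑ i : Fin 3, n x i * p x i = 0)
    (hmp : ∀ x ∈ Ω, ∑ i : Fin 3, m x i * p x i = 0)
    (s β : (Fin 3 → ℝ) → ℝ)
    (hs : ContDiffOn ℝ 2 s Ω) (hsc : ContinuousOn s (closure Ω))
    (hβ : ContDiffOn ℝ 2 β Ω) (hβc : ContinuousOn β (closure Ω))
    (heq1 : ∀ x ∈ Ω,
      lap s x = 3 * gradSq n x * s x + t * s x - Real.sqrt 6 * s x ^ 2
        + (4/3) * s x ^ 3 + 4 * β x ^ 2 * s x + 3 * Real.sqrt 6 * β x ^ 2)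
    (heq2 : ∀ x ∈ Ω,
      lap β x = (gradSq n x + 4 * gradMTp m p x + t + 2 * Real.sqrt 6 * s x
          + (4/3) * s x ^ 2) * β x + 4 * β x ^ 3)
    (hspos : ∀ x ∈ Ω, 0 ≤ s x)
    (hβbdry : ∀ x ∈ frontier Ω, β x = 0) :
    (∀ x ∈ Ω, β x = 0)
    ∧ ∀ x ∈ Ω, ∀ i j : Fin 3,
        s x * (n x i * n x j - kron i j / 3) + β x * (m x i * m x j - p x i * p x j)
          = s x * (n x i * n x j - kron i j / 3) := by
  have hcoef : ∀ x ∈ Ω, 0 ≤ gradSq n x + 4 * gradMTp m p x + t + 2 * Real.sqrt 6 * s x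
      + (4/3) * s x ^ 2 := by
    intro x hx
    have h1 : 0 ≤ gradSq n x :=
      Finset.sum_nonneg fun i _ => Finset.sum_nonneg fun k _ => sq_nonneg _
    have h2 : 0 ≤ gradMTp m p x := Finset.sum_nonneg fun j _ => sq_nonneg _
    have h3 := hspos x hx
    positivity
  have hle := nonpos_of_lap_pos hΩ hΩbd hβ hβc hβbdry fun x hx hpos => by
    rw [heq2 x hx]
    have := hcoef x hx
    positivity
  have hge := nonpos_of_lap_pos (f := -β) hΩ hΩbd hβ.neg hβc.neg
    (fun x hx => by simp [hβbdry x hx]) fun x hx hpos => by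
      have hpos' : 0 < -β x := hpos
      rw [lap_neg, heq2 x hx]
      have h1 := mul_nonneg (hcoef x hx) hpos'.le
      have h2 := pow_pos hpos' 3
      linarith [show (-β x) ^ 3 = -(β x ^ 3) by ring]
  have hzero : ∀ x ∈ Ω, β x = 0 := fun x hx =>
    le_antisymm (hle x hx) (neg_nonpos.mp (hge x hx))
  exact ⟨hzero, fun x hx i j => by rw [hzero x hx]; ring⟩

end
end

section
/- For real numbers q₁, q₂, q₃ and Q = q₁E₁ + q₂E₂ + q₃E₃, one has tr(Q²) = q₁² + q₂² + q₃², tr(Q³) = (√6/6) q₁ (q₁² − 3(q₂² + q₃²)), and (tr(Q²))³ − 6 (tr(Q³))² = (q₂² + q₃²) (q₂² + q₃² − 3 q₁²)². Consequently, Q is uniaxial if and only if q₂ = q₃ = 0 or q₁² = (1/3)(q₂² + q₃²). -/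
open Real Matrix

noncomputable section

/-- `E₁ = √(3/2) (e_z ⊗ e_z − I/3)`. -/
def E1 : Matrix (Fin 3) (Fin 3) ℝ :=
  Real.sqrt (3/2) • !![-(1/3 : ℝ), 0, 0; 0, -(1/3), 0; 0, 0, 2/3]

/-- `E₂ = √(1/2) (e_x ⊗ e_x − e_y ⊗ e_y)`. -/
def E2 : Matrix (Fin 3) (Fin 3) ℝ :=
  Real.sqrt (1/2) • !![(1 : ℝ), 0, 0; 0, -1, 0; 0, 0, 0]

/-- `E₃ = √(1/2) (e_x ⊗ e_y + e_y ⊗ e_x)`. -/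
def E3 : Matrix (Fin 3) (Fin 3) ℝ :=
  Real.sqrt (1/2) • !![(0 : ℝ), 1, 0; 1, 0, 0; 0, 0, 0]

theorem sqrt_three_halves_eq : Real.sqrt (3 / 2) = Real.sqrt 6 / 2 := by
  rw [show (3 / 2 : ℝ) = 6 / 2 ^ 2 by norm_num, Real.sqrt_div (by norm_num),
    Real.sqrt_sq (by norm_num)]

theorem smul_E1_add_smul_E2_add_smul_E3 (q₁ q₂ q₃ : ℝ) :
    q₁ • E1 + q₂ • E2 + q₃ • E3 =
      !![-(Real.sqrt 6 / 6 * q₁) + Real.sqrt (1 / 2) * q₂, Real.sqrt (1 / 2) * q₃, 0;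
        Real.sqrt (1 / 2) * q₃, -(Real.sqrt 6 / 6 * q₁) - Real.sqrt (1 / 2) * q₂, 0;
        0, 0, 2 * (Real.sqrt 6 / 6 * q₁)] := by
  rw [E1, E2, E3, sqrt_three_halves_eq]
  ext i j
  fin_cases i <;> fin_cases j <;> simp <;> ring

theorem trace_mul_self_of_block (x y z : ℝ) :
    (!![-x + y, z, 0; z, -x - y, 0; 0, 0, 2 * x] *
      !![-x + y, z, 0; z, -x - y, 0; 0, 0, 2 * x]).trace =
      6 * x ^ 2 + 2 * (y ^ 2 + z ^ 2) := by
  simp [Matrix.trace_fin_three]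
  ring

theorem trace_mul_mul_self_of_block (x y z : ℝ) :
    (!![-x + y, z, 0; z, -x - y, 0; 0, 0, 2 * x] *
      !![-x + y, z, 0; z, -x - y, 0; 0, 0, 2 * x] *
      !![-x + y, z, 0; z, -x - y, 0; 0, 0, 2 * x]).trace =
      6 * x * (x ^ 2 - (y ^ 2 + z ^ 2)) := by
  simp [Matrix.trace_fin_three]
  ring

/-- for `Q = q₁E₁ + q₂E₂ + q₃E₃`, `tr(Q²) = q₁² + q₂² + q₃²`,
`tr(Q³) = (√6/6) q₁ (q₁² − 3(q₂² + q₃²))`, and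
`(tr Q²)³ − 6 (tr Q³)² = (q₂² + q₃²)(q₂² + q₃² − 3q₁²)²`; consequently `Q` is uniaxial
(i.e. `(tr Q²)³ = 6 (tr Q³)²`) iff `q₂ = q₃ = 0` or `q₁² = (1/3)(q₂² + q₃²)`. -/
theorem stmt13 (q₁ q₂ q₃ : ℝ) (Q : Matrix (Fin 3) (Fin 3) ℝ)
    (hQ : Q = q₁ • E1 + q₂ • E2 + q₃ • E3) :
    (Q * Q).trace = q₁ ^ 2 + q₂ ^ 2 + q₃ ^ 2
    ∧ (Q * Q * Q).trace
        = (Real.sqrt 6 / 6) * q₁ * (q₁ ^ 2 - 3 * (q₂ ^ 2 + q₃ ^ 2))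
    ∧ ((Q * Q).trace) ^ 3 - 6 * ((Q * Q * Q).trace) ^ 2
        = (q₂ ^ 2 + q₃ ^ 2) * (q₂ ^ 2 + q₃ ^ 2 - 3 * q₁ ^ 2) ^ 2
    ∧ (((Q * Q).trace) ^ 3 = 6 * ((Q * Q * Q).trace) ^ 2
        ↔ (q₂ = 0 ∧ q₃ = 0) ∨ q₁ ^ 2 = (1/3) * (q₂ ^ 2 + q₃ ^ 2)) := by
  have h6 : Real.sqrt 6 ^ 2 = 6 := Real.sq_sqrt (by norm_num)
  have h2 : Real.sqrt (1 / 2) ^ 2 = 1 / 2 := Real.sq_sqrt (by norm_num)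
  have htr2 : (Q * Q).trace = q₁ ^ 2 + q₂ ^ 2 + q₃ ^ 2 := by
    rw [hQ, smul_E1_add_smul_E2_add_smul_E3, trace_mul_self_of_block]
    simp only [mul_pow, div_pow, h6, h2]
    ring
  have htr3 : (Q * Q * Q).trace
      = (Real.sqrt 6 / 6) * q₁ * (q₁ ^ 2 - 3 * (q₂ ^ 2 + q₃ ^ 2)) := by
    rw [hQ, smul_E1_add_smul_E2_add_smul_E3, trace_mul_mul_self_of_block]
    simp only [mul_pow, div_pow, h6, h2]
    ring
  have hdisc : ((Q * Q).trace) ^ 3 - 6 * ((Q * Q * Q).trace) ^ 2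
      = (q₂ ^ 2 + q₃ ^ 2) * (q₂ ^ 2 + q₃ ^ 2 - 3 * q₁ ^ 2) ^ 2 := by
    rw [htr2, htr3]
    simp only [mul_pow, div_pow, h6]
    ring
  refine ⟨htr2, htr3, hdisc, ?_⟩
  rw [← sub_eq_zero, hdisc, mul_eq_zero, sq_eq_zero_iff]
  refine or_congr ?_ ?_
  · rw [add_eq_zero_iff_of_nonneg (sq_nonneg _) (sq_nonneg _), sq_eq_zero_iff, sq_eq_zero_iff]
  · constructor <;> intro h <;> linarith

end
end

section
/- Let t, L₂ ∈ ℝ and let s : (0,∞) → ℝ be smooth and satisfy (1 + (2/3)L₂)(s''(r) + (2/r) s'(r)) = (1 + (2/3)L₂)(6/r²) s(r) + t s − √6 s² + (4/3) s³ for all r > 0. Then the radial-hedgehog field Q(x) = s(|x|) ( (x/|x|) ⊗ (x/|x|) − (1/3) I ) solves the anisotropic Landau–de Gennes Euler–Lagrange equations on ℝ³ \ {0}. -/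
open Real Set

noncomputable section

/-- The anisotropic Landau–de Gennes Euler–Lagrange equations on Ω. -/
def LdG_EL_aniso (t L2 : ℝ) (Ω : Set (Fin 3 → ℝ))
    (Q : (Fin 3 → ℝ) → Fin 3 → Fin 3 → ℝ) : Prop :=
  ∀ x ∈ Ω, ∀ i j : Fin 3,
    lap (fun y => Q y i j) x
      + (L2 / 2) *
        ((∑ k : Fin 3, pd k (fun y => pd j (fun z => Q z i k) y) x)
          + (∑ k : Fin 3, pd k (fun y => pd i (fun z => Q z j k) y) x)
          - (2/3) * kron i j *
              (∑ k : Fin 3, ∑ l : Fin 3, pd k (fun y => pd l (fun z => Q z k l) y) x))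
      = t * Q x i j
        - 3 * Real.sqrt 6 * ((∑ k : Fin 3, Q x i k * Q x k j) - (1/3) * kron i j * trQ2 Q x)
        + 2 * Q x i j * trQ2 Q x

/-- Euclidean radius `r = |x|`. -/
def rad (x : Fin 3 → ℝ) : ℝ := Real.sqrt (x 0 ^ 2 + x 1 ^ 2 + x 2 ^ 2)

/-- `f` is differentiable at `x`, with `i`-th partial derivative `c`. -/
def HasPd (i : Fin 3) (f : (Fin 3 → ℝ) → ℝ) (c : ℝ) (x : Fin 3 → ℝ) : Prop :=
  DifferentiableAt ℝ f x ∧ pd i f x = c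

namespace HasPd

variable {i : Fin 3} {f g : (Fin 3 → ℝ) → ℝ} {a b c : ℝ} {x : Fin 3 → ℝ}

lemma add (hf : HasPd i f a x) (hg : HasPd i g b x) :
    HasPd i (fun y => f y + g y) (a + b) x := by
  refine ⟨DifferentiableAt.add hf.1 hg.1, ?_⟩
  rw [← hf.2, ← hg.2, pd, fderiv_fun_add hf.1 hg.1]
  rfl

lemma mul (hf : HasPd i f a x) (hg : HasPd i g b x) :
    HasPd i (fun y => f y * g y) (f x * b + g x * a) x := by
  refine ⟨DifferentiableAt.mul hf.1 hg.1, ?_⟩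
  rw [← hf.2, ← hg.2, pd, fderiv_fun_mul hf.1 hg.1]
  rfl

lemma const (i : Fin 3) (a : ℝ) (x : Fin 3 → ℝ) : HasPd i (fun _ => a) 0 x :=
  ⟨differentiableAt_const a, by simp [pd]⟩

lemma coord (i j : Fin 3) (x : Fin 3 → ℝ) : HasPd i (fun y => y j) (kron i j) x := by
  refine ⟨differentiableAt_apply j x, ?_⟩
  rw [pd, (hasFDerivAt_apply j x).fderiv]
  simp [kron, Pi.single_apply, eq_comm]

lemma congr_of_eventuallyEq (hg : HasPd i g b x) (h : f =ᶠ[nhds x] g) :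
    HasPd i f b x :=
  ⟨DifferentiableAt.congr_of_eventuallyEq hg.1 h, by rw [pd, h.fderiv_eq]; exact hg.2⟩

end HasPd

lemma normSq_pos {x : Fin 3 → ℝ} (hx : x ≠ 0) : 0 < x 0 ^ 2 + x 1 ^ 2 + x 2 ^ 2 := by
  by_contra! h
  apply hx
  have h0 := sq_nonneg (x 0)
  have h1 := sq_nonneg (x 1)
  have h2 := sq_nonneg (x 2)
  ext i
  fin_cases i <;> simp only [Pi.zero_apply] <;> refine pow_eq_zero_iff two_ne_zero |>.1 ?_ <;>
    simp only [Fin.zero_eta, Fin.mk_one, Fin.reduceFinMk] <;> linarith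

lemma rad_pos {x : Fin 3 → ℝ} (hx : x ≠ 0) : 0 < rad x :=
  Real.sqrt_pos.2 (normSq_pos hx)

lemma sq_rad (x : Fin 3 → ℝ) : rad x ^ 2 = x 0 ^ 2 + x 1 ^ 2 + x 2 ^ 2 :=
  Real.sq_sqrt (by positivity)

/-- The chain rule for a radial function. -/
lemma HasPd.radial {φ : ℝ → ℝ} {φ' : ℝ} {x : Fin 3 → ℝ} (i : Fin 3) (hx : x ≠ 0)
    (h : HasDerivAt φ φ' (rad x)) : HasPd i (fun y => φ (rad y)) (φ' / rad x * x i) x := by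
  have hsq (j : Fin 3) : HasFDerivAt (fun y : Fin 3 → ℝ => y j ^ 2)
      ((2 * x j) • ContinuousLinearMap.proj (R := ℝ) (φ := fun _ : Fin 3 => ℝ) j) x := by
    simpa using (hasFDerivAt_apply (𝕜 := ℝ) j x).pow 2
  have hr := (((hsq 0).add (hsq 1)).add (hsq 2)).sqrt (normSq_pos hx).ne'
  have hφ := h.comp_hasFDerivAt x hr
  refine ⟨hφ.differentiableAt, ?_⟩
  have hpos := rad_pos hx
  refine (congrArg (fun L => L (Pi.single i 1)) hφ.fderiv).trans ?_
  change φ' * (1 / (2 * rad x) * (2 * x 0 * (Pi.single i (1 : ℝ) : Fin 3 → ℝ) 0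
    + 2 * x 1 * (Pi.single i (1 : ℝ) : Fin 3 → ℝ) 1
    + 2 * x 2 * (Pi.single i (1 : ℝ) : Fin 3 → ℝ) 2)) = _
  fin_cases i <;> simp <;> field_simp

/-- The first derivatives of `B(|x|) xᵢ xⱼ - δᵢⱼ s(|x|) / 3`, where `A = B' / r` and
`C = - s' / (3 r)`. -/
def radialTensorGrad (A B C : ℝ) (l i j : Fin 3) (x : Fin 3 → ℝ) : ℝ :=
  A * (x l * (x i * x j)) + B * (kron l i * x j + kron l j * x i) + C * (kron i j * x l)

/-- The second derivatives of `B(|x|) xᵢ xⱼ - δᵢⱼ s(|x|) / 3`, where `A = B' / r`, `P = A' / r`,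
`C = - s' / (3 r)` and `E = C' / r`. -/
def radialTensorHess (P A B C E : ℝ) (k l i j : Fin 3) (x : Fin 3 → ℝ) : ℝ :=
  P * (x k * x l * x i * x j)
    + A * (kron k l * x i * x j + kron k i * x l * x j + kron k j * x l * x i
      + kron l i * x k * x j + kron l j * x k * x i)
    + B * (kron l i * kron k j + kron l j * kron k i)
    + E * (kron i j * x k * x l) + C * (kron i j * kron k l)

lemma HasPd.radialTensor {s B : ℝ → ℝ} {s' B' : ℝ} {x : Fin 3 → ℝ} (l i j : Fin 3) (hx : x ≠ 0)
    (hB : HasDerivAt B B' (rad x)) (hs : HasDerivAt s s' (rad x)) :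
    HasPd l (fun y => B (rad y) * (y i * y j) + -(kron i j / 3) * s (rad y))
      (radialTensorGrad (B' / rad x) (B (rad x)) (-s' / (3 * rad x)) l i j x) x := by
  convert ((HasPd.radial l hx hB).mul ((coord l i x).mul (coord l j x))).add
    ((const l (-(kron i j / 3)) x).mul (radial l hx hs)) using 1
  have := (rad_pos hx).ne'
  simp only [radialTensorGrad]
  field_simp
  ring

lemma HasPd.radialTensorGrad {A B C : ℝ → ℝ} {A' B' C' : ℝ} {x : Fin 3 → ℝ} (k l i j : Fin 3)
    (hx : x ≠ 0) (hA : HasDerivAt A A' (rad x)) (hB : HasDerivAt B B' (rad x))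
    (hC : HasDerivAt C C' (rad x)) (hAB : B' / rad x = A (rad x)) :
    HasPd k (fun y => _root_.radialTensorGrad (A (rad y)) (B (rad y)) (C (rad y)) l i j y)
      (radialTensorHess (A' / rad x) (A (rad x)) (B (rad x)) (C (rad x)) (C' / rad x) k l i j x)
      x := by
  simp only [_root_.radialTensorGrad]
  convert (((radial k hx hA).mul ((coord k l x).mul ((coord k i x).mul (coord k j x)))).add
    ((radial k hx hB).mul (((const k (kron l i) x).mul (coord k j x)).add
      ((const k (kron l j) x).mul (coord k i x))))).add
    ((radial k hx hC).mul ((const k (kron i j) x).mul (coord k l x))) using 1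
  rw [hAB]
  simp only [radialTensorHess]
  ring

lemma sum_radialTensorHess_laplacian (P A B C E : ℝ) (i j : Fin 3) (x : Fin 3 → ℝ) :
    ∑ k, radialTensorHess P A B C E k k i j x
      = (P * rad x ^ 2 + 7 * A) * (x i * x j) + (2 * B + E * rad x ^ 2 + 3 * C) * kron i j := by
  rw [sq_rad]
  fin_cases i <;> fin_cases j <;>
    simp [Fin.sum_univ_three, radialTensorHess, kron] <;> ring

lemma sum_radialTensorHess_grad_div (P A B C E : ℝ) (i j : Fin 3) (x : Fin 3 → ℝ) :
    ∑ k, radialTensorHess P A B C E k j i k x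
      = (P * rad x ^ 2 + 6 * A + E) * (x i * x j) + (A * rad x ^ 2 + 4 * B + C) * kron i j := by
  rw [sq_rad]
  fin_cases i <;> fin_cases j <;>
    simp [Fin.sum_univ_three, radialTensorHess, kron] <;> ring

lemma sum_radialTensorHess_div_div (P A B C E : ℝ) (x : Fin 3 → ℝ) :
    ∑ k, ∑ l, radialTensorHess P A B C E k l k l x
      = (P * rad x ^ 2 + 6 * A + E) * rad x ^ 2 + 3 * (A * rad x ^ 2 + 4 * B + C) := by
  rw [sq_rad]
  simp [Fin.sum_univ_three, radialTensorHess, kron]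
  ring

lemma kron_comm (i j : Fin 3) : kron i j = kron j i := by
  simp [kron, eq_comm]

/-- The radial-hedgehog field with scalar order parameter `s`. -/
def hedgehog (s : ℝ → ℝ) (x : Fin 3 → ℝ) (i j : Fin 3) : ℝ :=
  s (rad x) * ((x i / rad x) * (x j / rad x) - kron i j / 3)

lemma sum_hedgehog_mul (s : ℝ → ℝ) {x : Fin 3 → ℝ} (hx : x ≠ 0) (i j : Fin 3) :
    ∑ k, hedgehog s x i k * hedgehog s x k j
      = s (rad x) ^ 2 * (x i * x j / (3 * rad x ^ 2) + kron i j / 9) := by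
  have hr := (rad_pos hx).ne'
  have hunit : (x 0 / rad x) ^ 2 + (x 1 / rad x) ^ 2 + (x 2 / rad x) ^ 2 = 1 := by
    field_simp
    exact (sq_rad x).symm
  have hn : x i * x j / (3 * rad x ^ 2) = (x i / rad x) * (x j / rad x) / 3 := by
    field_simp
  rw [hn]
  simp only [hedgehog]
  generalize s (rad x) = σ
  have key : ∀ n : Fin 3 → ℝ, n 0 ^ 2 + n 1 ^ 2 + n 2 ^ 2 = 1 →
      ∑ k, σ * (n i * n k - kron i k / 3) * (σ * (n k * n j - kron k j / 3))
        = σ ^ 2 * (n i * n j / 3 + kron i j / 9) := by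
    intro n hn
    have hsum : ∑ k, σ * (n i * n k - kron i k / 3) * (σ * (n k * n j - kron k j / 3))
        = σ ^ 2 * ((n 0 ^ 2 + n 1 ^ 2 + n 2 ^ 2) * (n i * n j) - 2 / 3 * (n i * n j)
          + kron i j / 9) := by
      fin_cases i <;> fin_cases j <;> simp [Fin.sum_univ_three, kron] <;> ring
    rw [hsum, hn]
    ring
  exact key (fun i => x i / rad x) hunit

lemma trQ2_hedgehog (s : ℝ → ℝ) {x : Fin 3 → ℝ} (hx : x ≠ 0) :
    trQ2 (hedgehog s) x = 2 / 3 * s (rad x) ^ 2 := by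
  have hr := (rad_pos hx).ne'
  rw [trQ2]
  simp only [sum_hedgehog_mul s hx]
  simp [Fin.sum_univ_three, kron]
  field_simp
  linear_combination (-9 * s (rad x) ^ 2) * sq_rad x

lemma pd_pd_hedgehog {s s' s'' : ℝ → ℝ} (hs : ∀ r, 0 < r → HasDerivAt s (s' r) r)
    (hs' : ∀ r, 0 < r → HasDerivAt s' (s'' r) r) {x : Fin 3 → ℝ} (hx : x ≠ 0)
    (k l i j : Fin 3) :
    pd k (fun y => pd l (fun z => hedgehog s z i j) y) x
      = radialTensorHess
          (s'' (rad x) / rad x ^ 4 - 5 * s' (rad x) / rad x ^ 5 + 8 * s (rad x) / rad x ^ 6)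
          (s' (rad x) / rad x ^ 3 - 2 * s (rad x) / rad x ^ 4)
          (s (rad x) / rad x ^ 2)
          (-s' (rad x) / (3 * rad x))
          (-(s'' (rad x) / rad x ^ 2 - s' (rad x) / rad x ^ 3) / 3) k l i j x := by
  set A : ℝ → ℝ := fun r => s' r / r ^ 3 - 2 * s r / r ^ 4 with hAdef
  set B : ℝ → ℝ := fun r => s r / r ^ 2 with hBdef
  set C : ℝ → ℝ := fun r => -s' r / (3 * r) with hCdef
  have hform : (fun z => hedgehog s z i j)
      = fun y => B (rad y) * (y i * y j) + -(kron i j / 3) * s (rad y) := by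
    funext y
    simp only [hedgehog, hBdef]
    ring
  have hB (r : ℝ) (hr : 0 < r) : HasDerivAt B (r * A r) r := by
    refine ((hs r hr).div (hasDerivAt_pow 2 r) (by positivity)).congr_deriv ?_
    simp only [hAdef]
    field_simp
    push_cast
    ring
  have hA (r : ℝ) (hr : 0 < r) :
      HasDerivAt A (r * (s'' r / r ^ 4 - 5 * s' r / r ^ 5 + 8 * s r / r ^ 6)) r := by
    refine (((hs' r hr).div (hasDerivAt_pow 3 r) (by positivity)).sub
      (((hs r hr).const_mul 2).div (hasDerivAt_pow 4 r) (by positivity))).congr_deriv ?_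
    field_simp
    push_cast
    ring
  have hC (r : ℝ) (hr : 0 < r) :
      HasDerivAt C (r * (-(s'' r / r ^ 2 - s' r / r ^ 3) / 3)) r := by
    refine ((hs' r hr).neg.div ((hasDerivAt_id r).const_mul 3) (by simp [hr.ne'])).congr_deriv ?_
    simp only [Pi.neg_apply, id]
    field_simp
    ring
  have hgrad : (fun y => pd l (fun z => hedgehog s z i j) y) =ᶠ[nhds x]
      fun y => radialTensorGrad (A (rad y)) (B (rad y)) (C (rad y)) l i j y := by
    filter_upwards [isOpen_ne.mem_nhds hx] with y hy
    have hr := rad_pos hy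
    rw [hform, (HasPd.radialTensor l i j hy (hB _ hr) (hs _ hr)).2,
      mul_div_cancel_left₀ _ hr.ne']
  have hr := rad_pos hx
  have h := ((HasPd.radialTensorGrad k l i j hx (hA _ hr) (hB _ hr) (hC _ hr)
    (mul_div_cancel_left₀ _ hr.ne')).congr_of_eventuallyEq hgrad).2
  rwa [mul_div_cancel_left₀ _ hr.ne', mul_div_cancel_left₀ _ hr.ne'] at h

/-- if `s : (0,∞) → ℝ` is smooth and satisfies the anisotropic
radial-hedgehog ODE, then the radial-hedgehog field
`Q(x) = s(|x|)((x/|x|) ⊗ (x/|x|) − I/3)` solves the anisotropic LdG Euler–Lagrange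
equations on `ℝ³ ∖ {0}`. -/
theorem stmt17 (t L2 : ℝ) (s : ℝ → ℝ)
    (hs : ContDiffOn ℝ (⊤ : ℕ∞) s (Ioi 0))
    (hODE : ∀ r : ℝ, 0 < r →
      (1 + (2/3) * L2) * (deriv (deriv s) r + (2 / r) * deriv s r)
        = (1 + (2/3) * L2) * (6 / r ^ 2) * s r
          + t * s r - Real.sqrt 6 * s r ^ 2 + (4/3) * s r ^ 3) :
    LdG_EL_aniso t L2 {x : Fin 3 → ℝ | x ≠ 0}
      (fun x i j => s (rad x) * ((x i / rad x) * (x j / rad x) - kron i j / 3)) := by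
  have hs1 : DifferentiableOn ℝ s (Ioi 0) := hs.differentiableOn (by simp)
  have hs2 : DifferentiableOn ℝ (deriv s) (Ioi 0) :=
    ((contDiffOn_infty_iff_deriv_of_isOpen isOpen_Ioi).1 hs).2.differentiableOn (by simp)
  have hds (r : ℝ) (hr : 0 < r) : HasDerivAt s (deriv s r) r :=
    (hs1.differentiableAt (Ioi_mem_nhds hr)).hasDerivAt
  have hds' (r : ℝ) (hr : 0 < r) : HasDerivAt (deriv s) (deriv (deriv s) r) r :=
    (hs2.differentiableAt (Ioi_mem_nhds hr)).hasDerivAt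
  change LdG_EL_aniso t L2 _ (hedgehog s)
  intro x hx i j
  have hr := rad_pos hx
  simp only [lap, pd_pd_hedgehog hds hds' hx, sum_radialTensorHess_laplacian,
    sum_radialTensorHess_grad_div, sum_radialTensorHess_div_div, sum_hedgehog_mul s hx,
    trQ2_hedgehog s hx, kron_comm j i]
  simp only [hedgehog]
  have hode := hODE _ hr
  generalize rad x = r at *
  generalize deriv (deriv s) r = s₂ at *
  generalize deriv s r = s₁ at *
  generalize s r = s₀ at *
  generalize kron i j = δ at *
  field_simp at hode ⊢
  linear_combination 18 * (3 * x i * x j - r ^ 2 * δ) * hode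

end
end
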